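/- arXiv:2006.02783 — 4 statements merged into one kernel-verified Lean document; each statement's English description precedes it below -/
import Mathlib

section
/- Let (α_n)_{n ≥ 1} be real numbers with 0 ≤ α_n ≤ 1, and consider the random subset A ⊆ ℤ+ in which the events {n ∈ A} are mutually independent with P(n ∈ A) = α_n. If E(A(x))/log x → ∞ as x → ∞, then with probability 1, A(x) ∼ E(A(x)); that is, almost surely A(x)/E(A(x)) → 1 as x → ∞. -/
open MeasureTheory Filter

/-- `countBelow A x` : the counting function `A(x) = #{a ∈ A : a ≤ x}`. -/
noncomputable def countBelow (A : Set ℕ) (x : ℝ) : ℕ :=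
  {a ∈ A | (a : ℝ) ≤ x}.ncard

/-- The random set attached to a point `ω` of the product space `{0,1}^ℕ`:
the set of positive integers `n` with `ω n = true`. -/
def randSet (ω : ℕ → Bool) : Set ℕ := {n | 1 ≤ n ∧ ω n = true}

/-- The expectation `E(A(x)) = ∑_{n ≤ x} α_n`. -/
noncomputable def expCount (α : ℕ → ℝ) (x : ℝ) : ℝ :=
  ∑ n ∈ Finset.Icc 1 ⌊x⌋₊, α n

theorem exp_mul_indicator_one {Ω : Type*} (A : Set Ω) (t : ℝ) :
    (fun ω => Real.exp (t * A.indicator (fun _ => (1 : ℝ)) ω)) =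
      fun ω => 1 + A.indicator (fun _ => Real.exp t - 1) ω := by
  ext ω
  by_cases hω : ω ∈ A <;> simp [hω]

section IndependentEvents

open ProbabilityTheory

variable {Ω ι : Type*} [MeasurableSpace Ω] {P : Measure Ω} [IsProbabilityMeasure P] {s : ι → Set Ω}

theorem mgf_indicator_one_le {A : Set Ω} (hA : MeasurableSet A) (t : ℝ) :
    mgf (A.indicator fun _ => (1 : ℝ)) P t ≤ Real.exp (P.real A * (Real.exp t - 1)) := by
  have hint : mgf (A.indicator fun _ => (1 : ℝ)) P t = 1 + P.real A * (Real.exp t - 1) := by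
    rw [mgf, exp_mul_indicator_one, integral_add (integrable_const _)
      ((integrable_const _).indicator hA), integral_indicator_const _ hA]
    simp
  rw [hint, add_comm]
  exact Real.add_one_le_exp _

theorem mgf_sum_indicator_one_le (hs : ∀ i, MeasurableSet (s i)) (hind : iIndepSet s P)
    (I : Finset ι) (t : ℝ) :
    mgf (∑ i ∈ I, (s i).indicator fun _ => (1 : ℝ)) P t ≤
      Real.exp ((∑ i ∈ I, P.real (s i)) * (Real.exp t - 1)) := by
  rw [hind.iIndepFun_indicator.mgf_sum (fun i => measurable_const.indicator (hs i)),
    Finset.sum_mul, Real.exp_sum]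
  exact Finset.prod_le_prod (fun _ _ => mgf_nonneg) fun i _ => mgf_indicator_one_le (hs i) t

theorem integrable_exp_mul_sum_indicator_one (hs : ∀ i, MeasurableSet (s i))
    (hind : iIndepSet s P) (I : Finset ι) (t : ℝ) :
    Integrable (fun ω => Real.exp (t * (∑ i ∈ I, (s i).indicator fun _ => (1 : ℝ)) ω)) P := by
  refine hind.iIndepFun_indicator.integrable_exp_mul_sum
    (fun i => measurable_const.indicator (hs i)) fun i _ => ?_
  rw [exp_mul_indicator_one]
  exact (integrable_const _).add ((integrable_const _).indicator (hs i))

/-- Two-sided multiplicative Chernoff bound for the number of independent events that occur. -/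
theorem measureReal_abs_sum_indicator_sub_ge_le (hs : ∀ i, MeasurableSet (s i))
    (hind : iIndepSet s P) (I : Finset ι) {ε : ℝ} (hε₀ : 0 ≤ ε) (hε₁ : ε ≤ 1) :
    P.real {ω | ε * ∑ i ∈ I, P.real (s i) ≤
        |∑ i ∈ I, (s i).indicator (fun _ => (1 : ℝ)) ω - ∑ i ∈ I, P.real (s i)|} ≤
      2 * Real.exp (-(ε ^ 2 / 4 * ∑ i ∈ I, P.real (s i))) := by
  set M := ∑ i ∈ I, P.real (s i)
  have hM₀ : 0 ≤ M := Finset.sum_nonneg fun _ _ => measureReal_nonneg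
  have hmgf := mgf_sum_indicator_one_le hs hind I
  have hint := integrable_exp_mul_sum_indicator_one hs hind I
  have hexp : ∀ t : ℝ, |t| ≤ 1 → Real.exp t - 1 ≤ t + t ^ 2 := fun t ht => by
    linarith [(abs_le.1 (Real.abs_exp_sub_one_sub_id_le ht)).2]
  have upper : P.real {ω | (1 + ε) * M ≤ (∑ i ∈ I, (s i).indicator fun _ => (1 : ℝ)) ω} ≤
      Real.exp (-(ε ^ 2 / 4 * M)) := by
    refine (measure_ge_le_exp_mul_mgf _ (by positivity : 0 ≤ ε / 2) (hint _)).trans ?_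
    refine (mul_le_mul_of_nonneg_left (hmgf _) (Real.exp_pos _).le).trans ?_
    rw [← Real.exp_add, Real.exp_le_exp]
    have := mul_le_mul_of_nonneg_left
      (hexp (ε / 2) (abs_le.2 ⟨by linarith, by linarith⟩)) hM₀
    linarith
  have lower : P.real {ω | (∑ i ∈ I, (s i).indicator fun _ => (1 : ℝ)) ω ≤ (1 - ε) * M} ≤
      Real.exp (-(ε ^ 2 / 4 * M)) := by
    refine (measure_le_le_exp_mul_mgf _ (by linarith : -(ε / 2) ≤ 0) (hint _)).trans ?_
    refine (mul_le_mul_of_nonneg_left (hmgf _) (Real.exp_pos _).le).trans ?_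
    rw [← Real.exp_add, Real.exp_le_exp]
    have := mul_le_mul_of_nonneg_left
      (hexp (-(ε / 2)) (abs_le.2 ⟨by linarith, by linarith⟩)) hM₀
    linarith
  have hsub : {ω | ε * M ≤ |∑ i ∈ I, (s i).indicator (fun _ => (1 : ℝ)) ω - M|} ⊆
      {ω | (1 + ε) * M ≤ (∑ i ∈ I, (s i).indicator fun _ => (1 : ℝ)) ω} ∪
      {ω | (∑ i ∈ I, (s i).indicator fun _ => (1 : ℝ)) ω ≤ (1 - ε) * M} := by
    intro ω hω
    simp only [Set.mem_union, Set.mem_ofPred_eq, Finset.sum_apply] at hω ⊢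
    rcases le_abs.1 hω with h | h
    · left; linarith
    · right; linarith
  linarith [measureReal_mono (μ := P) hsub, measureReal_union_le (μ := P)
    {ω | (1 + ε) * M ≤ (∑ i ∈ I, (s i).indicator fun _ => (1 : ℝ)) ω}
    {ω | (∑ i ∈ I, (s i).indicator fun _ => (1 : ℝ)) ω ≤ (1 - ε) * M}]

/-- If the expected number of occurring events grows faster than `log N`, then almost surely
the number of occurring events is asymptotic to its expectation. -/
theorem ae_tendsto_sum_indicator_div (hs : ∀ i, MeasurableSet (s i)) (hind : iIndepSet s P)
    (I : ℕ → Finset ι)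
    (hI : Tendsto (fun N : ℕ => (∑ i ∈ I N, P.real (s i)) / Real.log N) atTop atTop) :
    ∀ᵐ ω ∂P, Tendsto (fun N : ℕ => (∑ i ∈ I N, (s i).indicator (fun _ => (1 : ℝ)) ω) /
      ∑ i ∈ I N, P.real (s i)) atTop (nhds 1) := by
  set M : ℕ → ℝ := fun N => ∑ i ∈ I N, P.real (s i)
  have hgrow (c : ℝ) : ∀ᶠ N : ℕ in atTop, 0 < Real.log N ∧ c * Real.log N ≤ M N := by
    filter_upwards [hI.eventually_ge_atTop c, eventually_gt_atTop 1] with N hN hN₁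
    have hlog : 0 < Real.log N := Real.log_pos (by exact_mod_cast hN₁)
    exact ⟨hlog, (le_div_iff₀ hlog).1 hN⟩
  have hpos : ∀ᶠ N : ℕ in atTop, 0 < M N := by
    filter_upwards [hgrow 1] with N hN
    linarith
  have key (k : ℕ) : ∀ᵐ ω ∂P, ∀ᶠ N : ℕ in atTop,
      |∑ i ∈ I N, (s i).indicator (fun _ => (1 : ℝ)) ω - M N| < 1 / ((k : ℝ) + 1) * M N := by
    set ε : ℝ := 1 / ((k : ℝ) + 1) with hε
    have hε₀ : 0 < ε := by positivity
    have hε₁ : ε ≤ 1 := by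
      rw [hε, div_le_one (by positivity)]
      linarith [k.cast_nonneg (α := ℝ)]
    have hsum : Summable fun N : ℕ => P.real {ω | ε * M N ≤
        |∑ i ∈ I N, (s i).indicator (fun _ => (1 : ℝ)) ω - M N|} := by
      refine ((Real.summable_one_div_nat_pow.2 one_lt_two).mul_left 2).of_norm_bounded_eventually_nat
        ?_
      filter_upwards [hgrow (8 / ε ^ 2), eventually_gt_atTop 0] with N hN hN₀
      rw [Real.norm_of_nonneg measureReal_nonneg]
      refine (measureReal_abs_sum_indicator_sub_ge_le hs hind (I N) hε₀.le hε₁).trans ?_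
      have hN' : (0 : ℝ) < N := by exact_mod_cast hN₀
      have hpow : (1 : ℝ) / (N : ℝ) ^ 2 = Real.exp (-(2 * Real.log N)) := by
        rw [Real.exp_neg, two_mul, Real.exp_add, Real.exp_log hN', one_div, sq]
      rw [hpow]
      refine mul_le_mul_of_nonneg_left (Real.exp_le_exp.2 (neg_le_neg ?_)) zero_le_two
      calc 2 * Real.log N = ε ^ 2 / 4 * (8 / ε ^ 2 * Real.log N) := by field_simp; ring
        _ ≤ ε ^ 2 / 4 * M N := by gcongr; exact hN.2
    have hne := hsum.tsum_ofReal_ne_top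
    simp only [measureReal_def, ENNReal.ofReal_toReal (measure_ne_top P _)] at hne
    filter_upwards [ae_eventually_notMem hne] with ω hω
    filter_upwards [hω] with N hN
    simpa using hN
  filter_upwards [ae_all_iff.2 key] with ω hω
  rw [Metric.tendsto_nhds]
  intro ε hε
  obtain ⟨k, hk⟩ := exists_nat_one_div_lt hε
  filter_upwards [hω k, hpos] with N hN hMN
  rw [Real.dist_eq, div_sub_one hMN.ne', abs_div, abs_of_pos hMN]
  exact ((div_lt_iff₀ hMN).2 hN).trans hk

end IndependentEvents

theorem countBelow_randSet (ω : ℕ → Bool) (x : ℝ) :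
    (countBelow (randSet ω) x : ℝ) = ∑ n ∈ Finset.Icc 1 ⌊x⌋₊,
      {ω : ℕ → Bool | ω n = true}.indicator (fun _ => (1 : ℝ)) ω := by
  have h : {a ∈ randSet ω | (a : ℝ) ≤ x} =
      ((Finset.Icc 1 ⌊x⌋₊).filter fun n => ω n = true : Finset ℕ) := by
    ext a
    simp only [randSet, Set.mem_ofPred_eq, Finset.coe_filter, Finset.mem_Icc]
    constructor
    · rintro ⟨⟨h₁, h₂⟩, h₃⟩
      exact ⟨⟨h₁, (Nat.le_floor_iff' (by omega)).2 h₃⟩, h₂⟩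
    · rintro ⟨⟨h₁, h₂⟩, h₃⟩
      exact ⟨⟨h₁, h₃⟩, (Nat.le_floor_iff' (by omega)).1 h₂⟩
  rw [countBelow, h, Set.ncard_coe_finset, Finset.card_filter]
  simp [Set.indicator_apply]

theorem stmt10 (α : ℕ → ℝ) (hα : ∀ n, 0 ≤ α n ∧ α n ≤ 1)
    (P : Measure (ℕ → Bool)) [IsProbabilityMeasure P]
    (hind : ProbabilityTheory.iIndepSet (fun n => {ω : ℕ → Bool | ω n = true}) P)
    (hprob : ∀ n : ℕ, 1 ≤ n → P {ω : ℕ → Bool | ω n = true} = ENNReal.ofReal (α n))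
    (hE : Tendsto (fun x : ℝ => expCount α x / Real.log x) atTop atTop) :
    P {ω : ℕ → Bool | Tendsto
        (fun x : ℝ => (countBelow (randSet ω) x : ℝ) / expCount α x)
        atTop (nhds 1)} = 1 := by
  have hs (n : ℕ) : MeasurableSet {ω : ℕ → Bool | ω n = true} :=
    measurableSet_eq_fun (measurable_pi_apply n) measurable_const
  have hM (x : ℝ) : expCount α x =
      ∑ n ∈ Finset.Icc 1 ⌊x⌋₊, P.real {ω : ℕ → Bool | ω n = true} :=
    Finset.sum_congr rfl fun n hn => by
      rw [measureReal_def, hprob n (Finset.mem_Icc.1 hn).1, ENNReal.toReal_ofReal (hα n).1]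
  have hI := hE.comp tendsto_natCast_atTop_atTop
  simp only [Function.comp_def, hM, Nat.floor_natCast] at hI
  have hlim := ae_tendsto_sum_indicator_div hs hind (fun N => Finset.Icc 1 N) hI
  rw [← measure_univ (μ := P)]
  refine measure_congr (eventuallyEq_univ.2 ?_)
  filter_upwards [hlim] with ω hω
  simpa only [Set.mem_ofPred_eq, hM, countBelow_randSet, Function.comp_def] using
    hω.comp (tendsto_nat_floor_atTop (α := ℝ))
end

section
/- Let k be a positive integer and let 2 ≤ h ≤ k. Assume that for every η > 0 there exists a positive integer n_0(η) such that R_{(ℤ+)^k,h}(n) < n^η for every n ≥ n_0(η). Then for every 0 < κ < 1/k and every integer 2 ≤ l ≤ h there exists n_0(κ, l) such that R_{(ℤ+)^k,l}(n) < n^κ for every n > n_0(κ, l). -/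
/-- The set of k-th powers of positive integers. -/
def kPow (k : ℕ) : Set ℕ := {m | ∃ j : ℕ, 1 ≤ j ∧ m = j ^ k}

/-- `Rcnt A l n` : number of representations `n = a_1 + ... + a_l` with
`a_1 < a_2 < ... < a_l`, all terms in `A`. -/
noncomputable def Rcnt (A : Set ℕ) (l n : ℕ) : ℕ :=
  {f : Fin l → ℕ | StrictMono f ∧ (∀ i, f i ∈ A) ∧ ∑ i, f i = n}.ncard

theorem finite_setOf_strictMono_sum_eq (A : Set ℕ) (l n : ℕ) :
    {f : Fin l → ℕ | StrictMono f ∧ (∀ i, f i ∈ A) ∧ ∑ i, f i = n}.Finite := by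
  refine (Set.finite_Iic (fun _ : Fin l => n)).subset ?_
  rintro f ⟨-, -, hf⟩ i
  exact hf ▸ Finset.single_le_sum (fun j _ => Nat.zero_le (f j)) (Finset.mem_univ i)

/-- Appending a summand larger than `n` to the representations of `n`. -/
theorem Rcnt_le_Rcnt_succ {A : Set ℕ} {l n a : ℕ} (ha : a ∈ A) (hna : n < a) :
    Rcnt A l n ≤ Rcnt A (l + 1) (n + a) := by
  refine Set.ncard_le_ncard_of_injOn (fun f => (Fin.snoc f a : Fin (l + 1) → ℕ)) ?_ ?_
    (finite_setOf_strictMono_sum_eq A (l + 1) (n + a))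
  · rintro f ⟨hmono, hmem, hsum⟩
    have hlt : ∀ i, f i < a := fun i =>
      (hsum ▸ Finset.single_le_sum (fun j _ => Nat.zero_le (f j)) (Finset.mem_univ i) :
        f i ≤ n).trans_lt hna
    refine ⟨?_, ?_, ?_⟩
    · intro i j hij
      induction j using Fin.lastCases with
      | last =>
        induction i using Fin.lastCases with
        | last => exact absurd hij (lt_irrefl _)
        | cast i => simpa using hlt i
      | cast j =>
        induction i using Fin.lastCases with
        | last => exact absurd hij (Fin.le_last _).not_gt
        | cast i => simpa using hmono (Fin.castSucc_lt_castSucc_iff.mp hij)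
    · intro i
      induction i using Fin.lastCases with
      | last => simpa using ha
      | cast i => simpa using hmem i
    · simp [Fin.sum_univ_castSucc, hsum]
  · intro f _ g _ hfg
    exact (Fin.snoc_inj.mp hfg).1

theorem add_succ_pow_le_pow {k n : ℕ} (hk : 1 ≤ k) (hn : 2 ≤ n) :
    n + (n + 1) ^ k ≤ n ^ (2 * k + 1) := by
  have h₁ : (n + 1) ^ k ≤ n ^ (2 * k) := by
    rw [pow_mul]
    exact Nat.pow_le_pow_left (by nlinarith) k
  have h₂ : n ≤ n ^ (2 * k) := Nat.le_self_pow (by omega) n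
  have h₃ : n ^ (2 * k) * 2 ≤ n ^ (2 * k) * n := Nat.mul_le_mul_left _ hn
  rw [pow_succ]
  omega

/-- Subpolynomial growth of the number of representations passes from `l + 1` to `l` summands. -/
theorem exists_Rcnt_lt_rpow_of_succ {k l : ℕ} (hk : 1 ≤ k)
    (hyp : ∀ η : ℝ, 0 < η → ∃ n0 : ℕ, ∀ n : ℕ, n0 < n →
      (Rcnt (kPow k) (l + 1) n : ℝ) < (n : ℝ) ^ η) :
    ∀ η : ℝ, 0 < η → ∃ n0 : ℕ, ∀ n : ℕ, n0 < n → (Rcnt (kPow k) l n : ℝ) < (n : ℝ) ^ η := by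
  intro η hη
  have hd : (0 : ℝ) < ((2 * k + 1 : ℕ) : ℝ) := by positivity
  obtain ⟨n0, hn0⟩ := hyp (η / (2 * k + 1 : ℕ)) (div_pos hη hd)
  refine ⟨n0 + 1, fun n hn => ?_⟩
  have hlt : n < (n + 1) ^ k := Nat.lt_of_succ_le (Nat.le_self_pow (by omega) _)
  calc (Rcnt (kPow k) l n : ℝ)
      ≤ Rcnt (kPow k) (l + 1) (n + (n + 1) ^ k) := by
        exact_mod_cast Rcnt_le_Rcnt_succ (A := kPow k) ⟨n + 1, by omega, rfl⟩ hlt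
    _ < ((n + (n + 1) ^ k : ℕ) : ℝ) ^ (η / (2 * k + 1 : ℕ)) := hn0 _ (by omega)
    _ ≤ ((n : ℝ) ^ (2 * k + 1)) ^ (η / (2 * k + 1 : ℕ)) := by
        refine Real.rpow_le_rpow (by positivity) ?_ (div_pos hη hd).le
        exact_mod_cast add_succ_pow_le_pow hk (by omega)
    _ = (n : ℝ) ^ η := by
        rw [← Real.rpow_natCast, ← Real.rpow_mul (Nat.cast_nonneg n), mul_div_cancel₀ _ hd.ne']

theorem stmt11 (k h : ℕ) (hk : 1 ≤ k) (hh2 : 2 ≤ h) (hhk : h ≤ k)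
    (hyp : ∀ η : ℝ, 0 < η → ∃ n0 : ℕ, 1 ≤ n0 ∧ ∀ n : ℕ, n0 ≤ n →
      (Rcnt (kPow k) h n : ℝ) < (n : ℝ) ^ η) :
    ∀ κ : ℝ, 0 < κ → κ < 1 / (k : ℝ) → ∀ l : ℕ, 2 ≤ l → l ≤ h →
      ∃ n0 : ℕ, ∀ n : ℕ, n0 < n →
        (Rcnt (kPow k) l n : ℝ) < (n : ℝ) ^ κ := by
  intro κ hκ _ l _ hlh
  have key : ∀ η : ℝ, 0 < η → ∃ n0 : ℕ, ∀ n : ℕ, n0 < n →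
      (Rcnt (kPow k) l n : ℝ) < (n : ℝ) ^ η := by
    induction hlh using Nat.decreasingInduction with
    | self =>
      intro η hη
      obtain ⟨n0, -, hn0⟩ := hyp η hη
      exact ⟨n0, fun n hn => hn0 n hn.le⟩
    | of_succ m _ ih => exact exists_Rcnt_lt_rpow_of_succ hk (ih (by omega))
  exact key κ hκ
end

section
/- For every integer k ≥ 2 and every ε > 0 there exist a positive integer g and a B_2[g] set A ⊆ (ℤ+)^k together with a constant c > 0 such that A(x) ≥ c·x^{1/k − ε} for all sufficiently large x. -/
/-- `Rstar A h n` : number of representations `n = a_1 + ... + a_h`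
with `a_1 ≤ a_2 ≤ ... ≤ a_h`, all terms in `A`. -/
noncomputable def Rstar (A : Set ℕ) (h n : ℕ) : ℕ :=
  {f : Fin h → ℕ | Monotone f ∧ (∀ i, f i ∈ A) ∧ ∑ i, f i = n}.ncard

theorem Nat.exists_card_divisors_le_rpow (η : ℝ) (hη : 0 < η) :
    ∃ C : ℝ, 1 ≤ C ∧ ∀ n : ℕ, n ≠ 0 → (n.divisors.card : ℝ) ≤ C * (n : ℝ) ^ η := by
  obtain ⟨K, hK⟩ := exists_nat_gt ((2 : ℝ) ^ (1 / η))
  obtain ⟨D, hD⟩ := exists_nat_gt (1 / (η * Real.log 2))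
  have hl : 0 < Real.log 2 := Real.log_pos (by norm_num)
  have hD1 : (1 : ℝ) ≤ (D : ℝ) + 1 := by linarith [Nat.cast_nonneg (α := ℝ) D]
  have hsmall : ∀ e p : ℕ, 2 ≤ p → ((e : ℝ) + 1) ≤ (D + 1) * ((p : ℝ) ^ e) ^ η := by
    intro e p hp
    have h1 : ((2 : ℝ) ^ e) ^ η ≤ ((p : ℝ) ^ e) ^ η := by
      have : (2 : ℝ) ≤ p := by exact_mod_cast hp
      gcongr
    have h2 : 1 + (e : ℝ) * (η * Real.log 2) ≤ ((2 : ℝ) ^ e) ^ η := by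
      rw [Real.rpow_def_of_pos (by positivity), Real.log_pow]
      have := Real.add_one_le_exp ((e : ℝ) * Real.log 2 * η)
      linarith
    have h3 : 1 ≤ D * (η * Real.log 2) := by
      rw [div_lt_iff₀ (by positivity)] at hD
      exact hD.le
    have h4 : (e : ℝ) ≤ D * (e * (η * Real.log 2)) := by
      nlinarith [Nat.cast_nonneg (α := ℝ) e]
    have h5 : 0 ≤ (e : ℝ) * (η * Real.log 2) := by positivity
    calc (e : ℝ) + 1 ≤ (D + 1) * (1 + (e : ℝ) * (η * Real.log 2)) := by
          nlinarith [Nat.cast_nonneg (α := ℝ) D]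
      _ ≤ _ := by gcongr; exact h2.trans h1
  have hlarge : ∀ e p : ℕ, K ≤ p → ((e : ℝ) + 1) ≤ ((p : ℝ) ^ e) ^ η := by
    intro e p hp
    have h1 : (2 : ℝ) ≤ (p : ℝ) ^ η := by
      have : (2 : ℝ) ^ (1 / η) ≤ p := hK.le.trans (by exact_mod_cast hp)
      calc (2 : ℝ) = ((2 : ℝ) ^ (1 / η)) ^ η := by
            rw [← Real.rpow_mul (by norm_num), one_div_mul_cancel hη.ne', Real.rpow_one]
        _ ≤ _ := by gcongr
    calc (e : ℝ) + 1 ≤ 2 ^ e := by exact_mod_cast (Nat.lt_two_pow_self (n := e))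
      _ ≤ ((p : ℝ) ^ η) ^ e := by gcongr
      _ = _ := (Real.rpow_pow_comm (by positivity) _ _)
  refine ⟨((D : ℝ) + 1) ^ K, one_le_pow₀ hD1, fun n hn => ?_⟩
  have hprod : (n : ℝ) ^ η = ∏ p ∈ n.primeFactors, ((p : ℝ) ^ n.factorization p) ^ η := by
    rw [Real.finsetProd_rpow _ _ (fun i _ => by positivity)]
    congr 1
    conv_lhs => rw [← Nat.prod_factorization_pow_eq_self hn]
    rw [Finsupp.prod]
    push_cast
    rfl
  rw [Nat.card_divisors hn, hprod]
  push_cast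
  calc ∏ p ∈ n.primeFactors, ((n.factorization p : ℝ) + 1)
      ≤ ∏ p ∈ n.primeFactors, ((if p < K then ((D : ℝ) + 1) else 1) *
          ((p : ℝ) ^ n.factorization p) ^ η) := by
        refine Finset.prod_le_prod (fun _ _ => by positivity) fun p hp => ?_
        split_ifs with h
        · exact hsmall _ _ (Nat.prime_of_mem_primeFactors hp).two_le
        · rw [one_mul]; exact hlarge _ _ (not_lt.mp h)
    _ = (∏ p ∈ n.primeFactors, if p < K then ((D : ℝ) + 1) else 1) *
          ∏ p ∈ n.primeFactors, ((p : ℝ) ^ n.factorization p) ^ η := Finset.prod_mul_distrib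
    _ ≤ _ := by
        gcongr
        rw [Finset.prod_ite, Finset.prod_const, Finset.prod_const_one, mul_one]
        refine pow_le_pow_right₀ hD1 ?_
        calc _ ≤ (Finset.range K).card := Finset.card_le_card fun p hp => by
              simpa using (Finset.mem_filter.mp hp).2
          _ = K := Finset.card_range K

theorem Fintype.card_pi_constantOn_le {α : Type*} [Fintype α] [DecidableEq α] (q g : ℕ)
    (T : Finset α) (hT : T.card = g + 1) :
    (Finset.univ.filter fun f : α → Fin q => ∀ x ∈ T, ∀ y ∈ T, f x = f y).card ≤
      q ^ (Fintype.card α - g) := by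
  obtain ⟨t, ht⟩ : T.Nonempty := Finset.card_pos.mp (by omega)
  have hc : Fintype.card (↥((T.erase t)ᶜ) → Fin q) = q ^ (Fintype.card α - g) := by
    rw [Fintype.card_fun, Fintype.card_fin, Fintype.card_coe, Finset.card_compl,
      Finset.card_erase_of_mem ht, hT, Nat.add_sub_cancel]
  rw [← hc, ← Finset.card_univ]
  refine Finset.card_le_card_of_injOn (fun f x => f x) (fun _ _ => Finset.mem_coe.2 (Finset.mem_univ _)) ?_
  intro f hf f' hf' h
  simp only [Finset.coe_filter, Finset.mem_univ, true_and, Set.mem_ofPred_eq] at hf hf'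
  have key : ∀ x, x ∉ T.erase t → f x = f' x := fun x hx =>
    congrFun h ⟨x, Finset.mem_compl.2 hx⟩
  funext x
  by_cases hx : x ∈ T
  · rw [hf x hx t ht, hf' x hx t ht]
    exact key t (Finset.notMem_erase t T)
  · exact key x fun h => hx (Finset.mem_of_mem_erase h)

theorem Finset.exists_large_subset_card_inter_le {α : Type*} [Fintype α] [DecidableEq α]
    (q g s : ℕ) (hq : 0 < q) (F : Finset (Finset α)) (hs : ∀ S ∈ F, S.card ≤ s)
    (hF : F.card * s ^ (g + 1) < q ^ g) :
    ∃ A : Finset α, Fintype.card α ≤ q * A.card ∧ ∀ S ∈ F, (A ∩ S).card ≤ g := by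
  obtain hg | hg := le_or_gt (Fintype.card α) g
  · exact ⟨Finset.univ, by simpa using Nat.le_mul_of_pos_left _ hq,
      fun S _ => (Finset.card_le_univ _).trans hg⟩
  set 𝒯 := F.biUnion fun S => S.powersetCard (g + 1) with h𝒯
  have hcard : 𝒯.card ≤ F.card * s ^ (g + 1) := by
    refine Finset.card_biUnion_le_card_mul _ _ _ fun S hS => ?_
    rw [Finset.card_powersetCard]
    exact (Nat.choose_le_pow _ _).trans (Nat.pow_le_pow_left (hs S hS) _)
  set bad := 𝒯.biUnion fun T =>
    Finset.univ.filter fun f : α → Fin q => ∀ x ∈ T, ∀ y ∈ T, f x = f y with hbad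
  have hbc : bad.card < (Finset.univ : Finset (α → Fin q)).card := by
    calc bad.card ≤ 𝒯.card * q ^ (Fintype.card α - g) := by
          refine Finset.card_biUnion_le_card_mul _ _ _ fun T hT => ?_
          obtain ⟨S, _, hTS⟩ := Finset.mem_biUnion.1 hT
          exact Fintype.card_pi_constantOn_le q g T (Finset.mem_powersetCard.1 hTS).2
      _ < q ^ g * q ^ (Fintype.card α - g) :=
          Nat.mul_lt_mul_of_pos_right (hcard.trans_lt hF) (pow_pos hq _)
      _ = q ^ Fintype.card α := by rw [← pow_add]; congr 1; omega
      _ = _ := by rw [Finset.card_univ, Fintype.card_fun, Fintype.card_fin]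
  obtain ⟨f, -, hf⟩ := Finset.exists_mem_notMem_of_card_lt_card hbc
  obtain ⟨c, hc⟩ : ∃ c : Fin q,
      Fintype.card α ≤ q * (Finset.univ.filter fun x => f x = c).card := by
    by_contra! h
    have h1 : Fintype.card α = ∑ c : Fin q, (Finset.univ.filter fun x => f x = c).card := by
      rw [← Finset.card_univ]
      exact Finset.card_eq_sum_card_fiberwise fun _ _ => Finset.mem_coe.2 (Finset.mem_univ _)
    have : Nonempty (Fin q) := ⟨⟨0, hq⟩⟩
    have h2 := Finset.sum_lt_sum_of_nonempty (Finset.univ_nonempty (α := Fin q))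
      fun c _ => h c
    rw [← Finset.mul_sum, ← h1] at h2
    simp at h2
  refine ⟨_, hc, fun S hS => ?_⟩
  by_contra! hgt
  obtain ⟨T, hTsub, hTcard⟩ := Finset.exists_subset_card_eq (Nat.succ_le_of_lt hgt)
  refine hf (Finset.mem_biUnion.2 ⟨T, Finset.mem_biUnion.2 ⟨S, hS, Finset.mem_powersetCard.2
    ⟨hTsub.trans Finset.inter_subset_right, hTcard⟩⟩, ?_⟩)
  have hTc : ∀ x ∈ T, f x = c := fun x hx =>
    (Finset.mem_filter.1 (Finset.mem_of_mem_inter_left (hTsub hx))).2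
  exact Finset.mem_filter.2 ⟨Finset.mem_univ _, fun x hx y hy => by rw [hTc x hx, hTc y hy]⟩

theorem eq_of_coprime_of_mul_eq {x y x' y' : ℕ} (h : x.Coprime y) (h' : x'.Coprime y')
    (e : x * y' = x' * y) : x = x' ∧ y = y' := by
  have hx : x = x' := Nat.dvd_antisymm (h.dvd_of_dvd_mul_right (e ▸ Dvd.intro _ rfl))
    (h'.dvd_of_dvd_mul_right (e ▸ Dvd.intro _ rfl))
  have hy : y = y' := Nat.dvd_antisymm
    (h.symm.dvd_of_dvd_mul_left (e ▸ Dvd.intro_left _ rfl))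
    (h'.symm.dvd_of_dvd_mul_left (e ▸ Dvd.intro_left _ rfl))
  exact ⟨hx, hy⟩

theorem coprime_of_sq_add_sq {x y : ℕ} (h : x.Coprime y) : x.Coprime (x ^ 2 + y ^ 2) := by
  have : x.Coprime (y ^ 2) := h.pow_right 2
  rw [show x ^ 2 + y ^ 2 = y ^ 2 + x * x by ring]
  simpa using this

/-- Comparing two primitive representations of `d * e` as a sum of two squares. -/
theorem isCoprime_of_mul_eq_sq_add_sq {x y x0 y0 : ℕ} {d e : ℕ}
    (h : x.Coprime y) (h0 : x0.Coprime y0) (hn : x ^ 2 + y ^ 2 = d * e)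
    (hn0 : x0 ^ 2 + y0 ^ 2 = d * e)
    (hd : (d : ℤ) ∣ x0 * y - x * y0) (he : (e : ℤ) ∣ x0 * y + x * y0) : d.Coprime e := by
  refine Nat.coprime_of_dvd fun p hp hpd hpe => ?_
  have hpn : p ∣ x ^ 2 + y ^ 2 := hn ▸ hpd.mul_right e
  have hpn0 : p ∣ x0 ^ 2 + y0 ^ 2 := hn0 ▸ hpd.mul_right e
  by_cases hp2 : p = 2
  · subst hp2
    have h4 : 4 ∣ x ^ 2 + y ^ 2 := hn ▸ (mul_dvd_mul hpd hpe : 2 * 2 ∣ d * e)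
    have hx : 2 ∣ x ∧ 2 ∣ y := by
      rcases Nat.even_or_odd' x with ⟨a, rfl | rfl⟩ <;>
      rcases Nat.even_or_odd' y with ⟨b, rfl | rfl⟩ <;>
        first | omega | (ring_nf at h4; omega)
    have := Nat.dvd_gcd hx.1 hx.2
    rw [h] at this
    omega
  · have h1 : (p : ℤ) ∣ ((2 * (x0 * y) : ℕ) : ℤ) := by
      have := dvd_add ((Int.natCast_dvd_natCast.2 hpd).trans hd)
        ((Int.natCast_dvd_natCast.2 hpe).trans he)
      rwa [show (x0 : ℤ) * y - x * y0 + (x0 * y + x * y0) = ((2 * (x0 * y) : ℕ) : ℤ) by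
        push_cast; ring] at this
    rw [Int.natCast_dvd_natCast, hp.dvd_mul, hp.dvd_mul] at h1
    have key : ∀ {a b : ℕ}, a.Coprime b → p ∣ a ^ 2 + b ^ 2 → ¬ p ∣ a := fun hab hs ha =>
      hp.one_lt.ne' (Nat.eq_one_of_dvd_coprimes (coprime_of_sq_add_sq hab) ha hs)
    rcases h1 with h1 | h1 | h1
    · exact hp2 ((Nat.prime_dvd_prime_iff_eq hp Nat.prime_two).1 h1)
    · exact key h0 hpn0 h1
    · exact key h.symm (by rwa [add_comm]) h1

/-- Ordered pairs `u ≤ v` of positive integers with `u ^ k + v ^ k = n`. -/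
def powReps (k n : ℕ) : Finset (ℕ × ℕ) :=
  ((Finset.Icc 1 n) ×ˢ (Finset.Icc 1 n)).filter fun p => p.1 ≤ p.2 ∧ p.1 ^ k + p.2 ^ k = n

theorem mem_powReps {k n : ℕ} (hk : k ≠ 0) {p : ℕ × ℕ} :
    p ∈ powReps k n ↔ 1 ≤ p.1 ∧ p.1 ≤ p.2 ∧ p.1 ^ k + p.2 ^ k = n := by
  simp only [powReps, Finset.mem_filter, Finset.mem_product, Finset.mem_Icc]
  constructor
  · tauto
  · rintro ⟨h1, h2, h3⟩
    have := Nat.le_self_pow hk p.1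
    have := Nat.le_self_pow hk p.2
    omega

theorem card_coprime_sq_reps_le (n : ℕ) :
    ((powReps 2 n).filter fun p => p.1.Coprime p.2).card ≤ n.divisors.card := by
  rcases ((powReps 2 n).filter fun p => p.1.Coprime p.2).eq_empty_or_nonempty with h | ⟨⟨x0, y0⟩, h0⟩
  · simp [h]
  simp only [Finset.mem_filter, mem_powReps two_ne_zero] at h0
  obtain ⟨⟨hx0, hxy0, hn0⟩, hc0⟩ := h0
  have hnpos : 0 < n := by rw [← hn0]; positivity
  refine Finset.card_le_card_of_injOn
    (fun p => Int.gcd n ((x0 : ℤ) * p.2 - p.1 * y0)) (fun p _ => ?_) ?_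
  · exact Finset.mem_coe.2 (Nat.mem_divisors.2
      ⟨Int.natCast_dvd_natCast.1 (Int.gcd_dvd_left _ _), hnpos.ne'⟩)
  have key : ∀ p ∈ (powReps 2 n).filter fun p => p.1.Coprime p.2, ∀ d e : ℕ, n = d * e →
      d = Int.gcd n ((x0 : ℤ) * p.2 - p.1 * y0) →
      (d : ℤ) ∣ (x0 : ℤ) * p.2 - p.1 * y0 ∧ (e : ℤ) ∣ (x0 : ℤ) * p.2 + p.1 * y0 := by
    rintro ⟨x, y⟩ hp d e hde hd
    simp only [Finset.mem_filter, mem_powReps two_ne_zero] at hp hd ⊢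
    obtain ⟨⟨hx, hxy, hn⟩, hc⟩ := hp
    have hdw : (d : ℤ) ∣ (x0 : ℤ) * y - x * y0 := hd ▸ Int.gcd_dvd_right _ _
    refine ⟨hdw, ?_⟩
    have hdpos : 0 < d := Nat.pos_of_ne_zero (by rintro rfl; simp at hde; omega)
    obtain ⟨w, hw⟩ := hdw
    have hcop : Int.gcd e w = 1 := by
      have h1 : d = d * Int.gcd e w := by
        conv_lhs => rw [hd, hw, hde]
        push_cast
        rw [Int.gcd_mul_left]
        simp
      exact Nat.eq_of_mul_eq_mul_left hdpos (by omega)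
    have hprod : (d : ℤ) * e ∣ d * (w * ((x0 : ℤ) * y + x * y0)) := by
      refine ⟨(x0 : ℤ) ^ 2 - x ^ 2, ?_⟩
      have e1 : (x : ℤ) ^ 2 + y ^ 2 = d * e := by exact_mod_cast hn.trans hde
      have e2 : (x0 : ℤ) ^ 2 + y0 ^ 2 = d * e := by exact_mod_cast hn0.trans hde
      rw [← mul_assoc, ← hw]
      linear_combination (x0 : ℤ) ^ 2 * e1 - (x : ℤ) ^ 2 * e2
    have := Int.dvd_of_mul_dvd_mul_left (by exact_mod_cast hdpos.ne') hprod
    exact Int.dvd_of_dvd_mul_right_of_gcd_one this hcop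
  intro p hp p' hp' heq
  obtain ⟨e, he⟩ : Int.gcd n ((x0 : ℤ) * p.2 - p.1 * y0) ∣ n :=
    Int.natCast_dvd_natCast.1 (Int.gcd_dvd_left _ _)
  set d := Int.gcd n ((x0 : ℤ) * p.2 - p.1 * y0) with hd
  obtain ⟨h1, h2⟩ := key p hp d e he hd
  obtain ⟨h1', h2'⟩ := key p' hp' d e he heq
  obtain ⟨x, y⟩ := p
  obtain ⟨x', y'⟩ := p'
  simp only [Finset.coe_filter, Set.mem_ofPred_eq, mem_powReps two_ne_zero] at *
  obtain ⟨⟨hx, hxy, hn⟩, hc⟩ := hp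
  obtain ⟨⟨hx', hxy', hn'⟩, hc'⟩ := hp'
  have hde : d.Coprime e :=
    isCoprime_of_mul_eq_sq_add_sq hc hc0 (hn.trans he) (hn0.trans he) h1 h2
  have hx0n : IsCoprime (n : ℤ) x0 := by
    rw [Nat.isCoprime_iff_coprime, ← hn0]
    exact (coprime_of_sq_add_sq hc0).symm
  have hdn : (d : ℤ) ∣ n := ⟨e, by exact_mod_cast he⟩
  have hen : (e : ℤ) ∣ n := ⟨d, by rw [mul_comm]; exact_mod_cast he⟩
  have hdd : (d : ℤ) ∣ (x : ℤ) * y' - x' * y := by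
    refine (hx0n.of_isCoprime_of_dvd_left hdn).dvd_of_dvd_mul_left ?_
    have := dvd_sub (h1'.mul_left x) (h1.mul_left x')
    convert this using 1
    ring
  have hee : (e : ℤ) ∣ (x : ℤ) * y' - x' * y := by
    refine (hx0n.of_isCoprime_of_dvd_left hen).dvd_of_dvd_mul_left ?_
    have := dvd_sub (h2'.mul_left x) (h2.mul_left x')
    convert this using 1
    ring
  have hnn : (n : ℤ) ∣ (x : ℤ) * y' - x' * y := by
    have := (Nat.isCoprime_iff_coprime.2 hde).mul_dvd hdd hee
    rw [he]
    exact_mod_cast this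
  have hz : (x : ℤ) * y' - x' * y = 0 := by
    refine Int.eq_zero_of_abs_lt_dvd hnn ?_
    zify at hn hn' hx hx' hxy hxy'
    rw [abs_lt]
    constructor <;> nlinarith [sq_nonneg ((x : ℤ) - y'), sq_nonneg ((x' : ℤ) - y)]
  obtain ⟨rfl, rfl⟩ := eq_of_coprime_of_mul_eq hc hc' (by zify; linarith)
  rfl

theorem card_powReps_two_le (n : ℕ) (hn : n ≠ 0) :
    (powReps 2 n).card ≤ n.divisors.card ^ 2 := by
  have hmaps : ∀ p ∈ powReps 2 n, p.1.gcd p.2 ∈ n.divisors := fun p hp => by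
    rw [mem_powReps two_ne_zero] at hp
    refine Nat.mem_divisors.2 ⟨?_, hn⟩
    rw [← hp.2.2]
    exact dvd_add ((Nat.gcd_dvd_left _ _).trans (dvd_pow_self _ two_ne_zero))
      ((Nat.gcd_dvd_right _ _).trans (dvd_pow_self _ two_ne_zero))
  rw [sq]
  refine Finset.card_le_mul_card_image_of_maps_to hmaps _ fun h _ => ?_
  rcases ((powReps 2 n).filter fun p => p.1.gcd p.2 = h).eq_empty_or_nonempty with he | ⟨p, hp⟩
  · simp [he]
  have red : ∀ p ∈ (powReps 2 n).filter fun p => p.1.gcd p.2 = h, 0 < h ∧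
      h * (p.1 / h) = p.1 ∧ h * (p.2 / h) = p.2 ∧ (p.1 / h).Coprime (p.2 / h) := by
    intro p hp
    simp only [Finset.mem_filter, mem_powReps two_ne_zero] at hp
    obtain ⟨⟨h1, h2, h3⟩, rfl⟩ := hp
    have hpos : 0 < p.1.gcd p.2 := Nat.gcd_pos_of_pos_left _ h1
    exact ⟨hpos, Nat.mul_div_cancel' (Nat.gcd_dvd_left _ _),
      Nat.mul_div_cancel' (Nat.gcd_dvd_right _ _), Nat.coprime_div_gcd_div_gcd hpos⟩
  have sqs : ∀ p ∈ (powReps 2 n).filter fun p => p.1.gcd p.2 = h,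
      n = h ^ 2 * ((p.1 / h) ^ 2 + (p.2 / h) ^ 2) := by
    intro p hp
    obtain ⟨-, h1, h2, -⟩ := red p hp
    simp only [Finset.mem_filter, mem_powReps two_ne_zero] at hp
    rw [mul_add, ← mul_pow, ← mul_pow, h1, h2, hp.1.2.2]
  have hpos := (red p hp).1
  set m := (p.1 / h) ^ 2 + (p.2 / h) ^ 2 with hm
  have hnm : n = h ^ 2 * m := sqs p hp
  calc _ ≤ ((powReps 2 m).filter fun p => p.1.Coprime p.2).card := by
        refine Finset.card_le_card_of_injOn (fun p => (p.1 / h, p.2 / h)) (fun r hr => ?_) ?_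
        · have hr' := Finset.mem_coe.1 hr
          obtain ⟨-, h1, h2, h3⟩ := red r hr'
          have h4 := sqs r hr'
          simp only [Finset.mem_filter, mem_powReps two_ne_zero] at hr'
          simp only [Finset.coe_filter, Set.mem_ofPred_eq, mem_powReps two_ne_zero]
          refine ⟨⟨?_, Nat.div_le_div_right hr'.1.2.1, ?_⟩, h3⟩
          · refine Nat.pos_of_ne_zero fun (h0 : r.1 / h = 0) => ?_
            rw [h0] at h1
            omega
          · exact Nat.eq_of_mul_eq_mul_left (pow_pos hpos 2) (h4.symm.trans hnm)
        · intro r hr r' hr' heq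
          obtain ⟨-, h1, h2, -⟩ := red r (Finset.mem_coe.1 hr)
          obtain ⟨-, h1', h2', -⟩ := red r' (Finset.mem_coe.1 hr')
          simp only [Prod.mk.injEq] at heq
          ext
          · rw [← h1, ← h1', heq.1]
          · rw [← h2, ← h2', heq.2]
    _ ≤ m.divisors.card := card_coprime_sq_reps_le m
    _ ≤ n.divisors.card := Finset.card_le_card (Nat.divisors_subset_of_dvd hn ⟨h ^ 2, by
        rw [hnm, mul_comm]⟩)

theorem pow_add_pow_lt {k : ℕ} (hk : 2 ≤ k) {b c t : ℕ} (hcb : c < b) (ht : 0 < t) :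
    (c + t) ^ k + b ^ k < (b + t) ^ k + c ^ k := by
  induction k, hk using Nat.le_induction with
  | base => nlinarith
  | succ k hk ih =>
    have h1 : c ^ k ≤ b ^ k := Nat.pow_le_pow_left hcb.le k
    have h2 : b ^ k ≤ (b + t) ^ k := Nat.pow_le_pow_left (by omega) k
    have h3 : c ^ k ≤ (c + t) ^ k := Nat.pow_le_pow_left (by omega) k
    simp only [pow_succ]
    zify at *
    nlinarith [mul_nonneg (sub_nonneg.2 hcb.le) (sub_nonneg.2 h2),
      mul_nonneg ht.le (sub_nonneg.2 h1), mul_pos (show (0 : ℤ) < c + t by omega) (sub_pos.2 ih)]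

theorem card_powReps_odd_le {k : ℕ} (hk : 2 ≤ k) (ho : Odd k) (n : ℕ) (hn : n ≠ 0) :
    (powReps k n).card ≤ n.divisors.card := by
  have hk0 : k ≠ 0 := by omega
  have key : ∀ u v u' v' : ℕ, u ≤ v → u + v = u' + v' → u ^ k + v ^ k = n →
      u' ^ k + v' ^ k = n → ¬ v < v' := by
    intro u v u' v' huv hs h h' hlt
    obtain ⟨t, rfl⟩ := Nat.exists_eq_add_of_lt hlt
    have hu : u = u' + (t + 1) := by omega
    have := pow_add_pow_lt hk (show u' < v by omega) (Nat.succ_pos t)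
    rw [Nat.succ_eq_add_one, ← hu, ← add_assoc] at this
    omega
  refine Finset.card_le_card_of_injOn (fun p => p.1 + p.2) (fun p hp => ?_) ?_
  · have := (mem_powReps hk0).1 (Finset.mem_coe.1 hp)
    exact Finset.mem_coe.2 (Nat.mem_divisors.2 ⟨this.2.2 ▸ ho.nat_add_dvd_pow_add_pow _ _, hn⟩)
  · intro p hp p' hp' heq
    obtain ⟨h1, h2, h3⟩ := (mem_powReps hk0).1 (Finset.mem_coe.1 hp)
    obtain ⟨h1', h2', h3'⟩ := (mem_powReps hk0).1 (Finset.mem_coe.1 hp')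
    simp only at heq
    have := key _ _ _ _ h2 heq h3 h3'
    have := key _ _ _ _ h2' heq.symm h3' h3
    ext <;> omega

theorem card_powReps_le {k : ℕ} (hk : 2 ≤ k) (n : ℕ) (hn : n ≠ 0) :
    (powReps k n).card ≤ n.divisors.card ^ 2 := by
  rcases Nat.even_or_odd' k with ⟨m, rfl | hm⟩
  · have hm : m ≠ 0 := by omega
    refine le_trans (Finset.card_le_card_of_injOn (fun p => (p.1 ^ m, p.2 ^ m)) (fun p hp => ?_) ?_)
      (card_powReps_two_le n hn)
    · obtain ⟨h1, h2, h3⟩ := (mem_powReps (by omega)).1 (Finset.mem_coe.1 hp)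
      refine Finset.mem_coe.2 ((mem_powReps two_ne_zero).2
        ⟨Nat.one_le_pow _ _ h1, Nat.pow_le_pow_left h2 m, ?_⟩)
      rw [← h3, ← pow_mul, ← pow_mul, mul_comm]
    · intro p _ p' _ heq
      simp only [Prod.mk.injEq] at heq
      exact Prod.ext (Nat.pow_left_injective hm heq.1) (Nat.pow_left_injective hm heq.2)
  · exact (card_powReps_odd_le hk ⟨m, hm⟩ n hn).trans (Nat.le_self_pow two_ne_zero _)

open scoped Classical in
theorem exists_dense_block {k : ℕ} (hk : 2 ≤ k) {δ : ℝ} (hδ : 0 < δ) :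
    ∃ g : ℕ, 1 ≤ g ∧ ∃ c : ℝ, 0 < c ∧ ∀ L : ℕ, 1 ≤ L → ∃ A : Finset ℕ,
      A ⊆ Finset.Ioc L (2 * L) ∧ c * (L : ℝ) ^ (1 - δ) ≤ A.card ∧
      ∀ n, (A.filter fun v => ∃ u, 1 ≤ u ∧ u ≤ v ∧ u ^ k + v ^ k = n).card ≤ g := by
  have hk0 : (0 : ℝ) < k := by exact_mod_cast (by omega : 0 < k)
  obtain ⟨C, hC1, hC⟩ := Nat.exists_card_divisors_le_rpow (δ / (8 * k)) (by positivity)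
  obtain ⟨w, hw⟩ := exists_nat_ge (8 / δ)
  set D : ℝ := 2 * (C ^ 2) ^ 2 with hD
  have hC2 : 1 ≤ C ^ 2 := one_le_pow₀ hC1
  have hD1 : 1 ≤ D := by nlinarith
  refine ⟨w + 1, by omega, 1 / (2 * D * 4 ^ δ), by positivity, fun L hL => ?_⟩
  have hLR : (1 : ℝ) ≤ L := by exact_mod_cast hL
  have hL0 : (0 : ℝ) < L := by linarith
  set X : ℝ := (4 * L : ℝ) ^ (δ / 4) with hX
  have hX1 : 1 ≤ X := Real.one_le_rpow (by linarith) (by positivity)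
  have hX4 : X ^ 4 = (4 * L : ℝ) ^ δ := by
    rw [hX, ← Real.rpow_mul_natCast (by positivity)]
    congr 1
    push_cast
    ring
  have hXw : (4 * L : ℝ) ^ 2 ≤ X ^ w := by
    rw [hX, ← Real.rpow_mul_natCast (by positivity), ← Real.rpow_natCast]
    refine Real.rpow_le_rpow_of_exponent_le (by linarith) ?_
    rw [div_le_iff₀ hδ] at hw
    push_cast
    linarith
  set q : ℕ := ⌈D * X ^ 4⌉₊ with hq
  have hqpos : 0 < q := Nat.ceil_pos.2 (by positivity)
  set s : ℕ := ⌊C ^ 2 * X⌋₊ with hs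
  set P : Finset ℕ := ((Finset.Icc 1 (2 * L)) ×ˢ (Finset.Icc 1 (2 * L))).image
    fun p => p.1 ^ k + p.2 ^ k with hP
  set S : ℕ → Finset (Finset.Ioc L (2 * L)) := fun n =>
    Finset.univ.filter fun v => ∃ u, 1 ≤ u ∧ u ≤ (v : ℕ) ∧ u ^ k + (v : ℕ) ^ k = n with hS
  have hScard : ∀ T ∈ P.image S, T.card ≤ s := by
    intro T hT
    obtain ⟨n, hn, rfl⟩ := Finset.mem_image.1 hT
    obtain ⟨⟨a, b⟩, hab, hn'⟩ := Finset.mem_image.1 hn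
    simp only [Finset.mem_product, Finset.mem_Icc] at hab hn'
    have hn0 : n ≠ 0 := by
      have := Nat.one_le_pow k a hab.1.1
      omega
    have hn4 : (n : ℝ) ≤ (4 * L : ℝ) ^ k := by
      have h1 : a ^ k ≤ (2 * L) ^ k := Nat.pow_le_pow_left hab.1.2 k
      have h2 : b ^ k ≤ (2 * L) ^ k := Nat.pow_le_pow_left hab.2.2 k
      have h3 : 2 ≤ 2 ^ k := Nat.le_self_pow (by omega) 2
      have h4 : (4 * L) ^ k = 2 ^ k * (2 * L) ^ k := by rw [← mul_pow]; congr 1; ring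
      have : n ≤ (4 * L) ^ k := by rw [h4]; nlinarith
      exact_mod_cast this
    refine Nat.le_floor ?_
    have h1 : (S n).card ≤ (powReps k n).card := by
      have : (S n).card ≤ ((powReps k n).image Prod.snd).card := by
        refine Finset.card_le_card_of_injOn Subtype.val (fun v hv => ?_)
          Subtype.val_injective.injOn
        obtain ⟨-, u, h1, h2, h3⟩ := Finset.mem_filter.1 (Finset.mem_coe.1 hv)
        exact Finset.mem_coe.2 (Finset.mem_image.2
          ⟨(u, v), (mem_powReps (by omega)).2 ⟨h1, h2, h3⟩, rfl⟩)
      exact this.trans Finset.card_image_le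
    have h2 : ((S n).card : ℝ) ≤ (n.divisors.card : ℝ) ^ 2 := by
      exact_mod_cast h1.trans (card_powReps_le hk n hn0)
    calc ((S n).card : ℝ) ≤ (n.divisors.card : ℝ) ^ 2 := h2
      _ ≤ (C * (n : ℝ) ^ (δ / (8 * k))) ^ 2 := by gcongr; exact hC n hn0
      _ ≤ (C * ((4 * L : ℝ) ^ k) ^ (δ / (8 * k))) ^ 2 := by gcongr
      _ = C ^ 2 * X := by
        rw [mul_pow, ← Real.rpow_natCast_mul (by positivity), ← Real.rpow_mul_natCast (by positivity), hX]
        congr 2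
        push_cast
        field_simp
        norm_num
  have hPcard : ((P.image S).card : ℝ) ≤ (4 * L : ℝ) ^ 2 := by
    have : (P.image S).card ≤ (2 * L) * (2 * L) := by
      refine (Finset.card_image_le.trans Finset.card_image_le).trans ?_
      simp
    have : ((P.image S).card : ℝ) ≤ (2 * L) * (2 * L) := by exact_mod_cast this
    nlinarith
  have hcount : (P.image S).card * s ^ (w + 1 + 1) < q ^ (w + 1) := by
    have hsR : (s : ℝ) ≤ C ^ 2 * X := Nat.floor_le (by positivity)
    have hqR : D * X ^ 4 ≤ q := Nat.le_ceil _
    have : ((P.image S).card : ℝ) * (s : ℝ) ^ (w + 1 + 1) < (q : ℝ) ^ (w + 1) := by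
      calc ((P.image S).card : ℝ) * (s : ℝ) ^ (w + 1 + 1)
          ≤ X ^ w * (C ^ 2 * X) ^ (w + 1 + 1) := by gcongr; exact hPcard.trans hXw
        _ = (C ^ 2) ^ (w + 2) * X ^ (2 * w + 2) := by ring
        _ ≤ (C ^ 2) ^ (2 * (w + 1)) * X ^ (4 * (w + 1)) := by
          gcongr <;> first | assumption | omega
        _ < 2 ^ (w + 1) * ((C ^ 2) ^ (2 * (w + 1)) * X ^ (4 * (w + 1))) :=
          lt_mul_of_one_lt_left (by positivity) (one_lt_pow₀ (by norm_num) (by omega))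
        _ = (D * X ^ 4) ^ (w + 1) := by rw [hD, mul_pow, mul_pow, pow_mul, pow_mul, mul_assoc]
        _ ≤ (q : ℝ) ^ (w + 1) := by gcongr
    exact_mod_cast this
  obtain ⟨A, hA1, hA2⟩ :=
    Finset.exists_large_subset_card_inter_le q (w + 1) s hqpos (P.image S) hScard hcount
  refine ⟨A.map (Function.Embedding.subtype _), fun v hv => ?_, ?_, fun n => ?_⟩
  · obtain ⟨x, -, rfl⟩ := Finset.mem_map.1 hv
    exact x.2
  · rw [Finset.card_map]
    have hAq : (L : ℝ) ≤ q * A.card := by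
      have : L ≤ q * A.card := by
        simpa [two_mul] using hA1
      exact_mod_cast this
    have hq2 : (q : ℝ) ≤ 2 * D * (4 ^ δ * (L : ℝ) ^ δ) := by
      rw [← Real.mul_rpow (by norm_num) (by positivity), ← hX4]
      have h1 := Nat.ceil_lt_add_one (show 0 ≤ D * X ^ 4 by positivity)
      have h2 : 1 ≤ D * X ^ 4 := one_le_mul_of_one_le_of_one_le hD1 (one_le_pow₀ hX1)
      linarith
    rw [Real.rpow_sub hL0, Real.rpow_one, div_mul_div_comm, one_mul, div_le_iff₀ (by positivity)]
    calc (L : ℝ) ≤ q * A.card := hAq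
      _ ≤ (2 * D * (4 ^ δ * (L : ℝ) ^ δ)) * A.card := by gcongr
      _ = _ := by ring
  · by_cases hn : n ∈ P
    · refine le_trans ?_ (hA2 (S n) (Finset.mem_image_of_mem S hn))
      rw [Finset.filter_map, Finset.card_map]
      refine Finset.card_le_card fun v hv => ?_
      obtain ⟨h1, h2⟩ := Finset.mem_filter.1 hv
      exact Finset.mem_inter.2 ⟨h1, Finset.mem_filter.2 ⟨Finset.mem_univ _, h2⟩⟩
    · rw [Finset.card_eq_zero.2]
      · exact Nat.zero_le _
      refine Finset.filter_eq_empty_iff.2 fun v hv => ?_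
      rintro ⟨u, h1, h2, h3⟩
      obtain ⟨x, -, rfl⟩ := Finset.mem_map.1 hv
      have := Finset.mem_Ioc.1 x.2
      refine hn (Finset.mem_image.2 ⟨(u, x), ?_, h3⟩)
      simp only [Finset.mem_product, Finset.mem_Icc, Function.Embedding.subtype_apply] at *
      omega

theorem not_lt_of_pow_add_pow_eq {k : ℕ} (hk : k ≠ 0) {i j u v u' v' : ℕ} (huv : u ≤ v)
    (hv : v ≤ 2 * 4 ^ i) (hv' : 4 ^ j < v') (h : u ^ k + v ^ k = u' ^ k + v' ^ k) : ¬ i < j := by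
  intro hij
  have h1 : 4 ^ (i + 1) ≤ 4 ^ j := Nat.pow_le_pow_right (by norm_num) hij
  have h2 : 2 * v < v' := by rw [pow_succ] at h1; omega
  have h3 : (2 * v) ^ k < v' ^ k := Nat.pow_lt_pow_left h2 hk
  have h4 : u ^ k ≤ v ^ k := Nat.pow_le_pow_left huv k
  have h5 : 2 ≤ 2 ^ k := Nat.le_self_pow hk 2
  rw [mul_pow] at h3
  have h6 : 2 * v ^ k ≤ 2 ^ k * v ^ k := Nat.mul_le_mul_right _ h5
  have h7 := Nat.zero_le (u' ^ k)
  omega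

open scoped Classical in
theorem Rstar_two_le {k : ℕ} (hk : k ≠ 0) {g : ℕ} {B : ℕ → Finset ℕ}
    (hB : ∀ j, B j ⊆ Finset.Ioc (4 ^ j) (2 * 4 ^ j))
    (hg : ∀ j n, ((B j).filter fun v => ∃ u, 1 ≤ u ∧ u ≤ v ∧ u ^ k + v ^ k = n).card ≤ g)
    (n : ℕ) : Rstar {m | ∃ j, ∃ v ∈ B j, m = v ^ k} 2 n ≤ g := by
  rw [Rstar]
  rcases Set.eq_empty_or_nonempty {f : Fin 2 → ℕ | Monotone f ∧
      (∀ i, f i ∈ {m | ∃ j, ∃ v ∈ B j, m = v ^ k}) ∧ ∑ i, f i = n} with he | ⟨f₀, hf₀⟩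
  · rw [he, Set.ncard_empty]
    exact Nat.zero_le _
  have unpack : ∀ f : Fin 2 → ℕ, (Monotone f ∧
      (∀ i, f i ∈ {m | ∃ j, ∃ v ∈ B j, m = v ^ k}) ∧ ∑ i, f i = n) →
      ∃ u v j, v ∈ B j ∧ 1 ≤ u ∧ u ≤ v ∧ u ^ k + v ^ k = n ∧ f 0 = u ^ k ∧ f 1 = v ^ k := by
    rintro f ⟨hm, hA, hs⟩
    obtain ⟨i, u, hu, hfu⟩ := hA 0
    obtain ⟨j, v, hv, hfv⟩ := hA 1
    have h01 : f 0 ≤ f 1 := hm (by decide)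
    rw [Fin.sum_univ_two] at hs
    refine ⟨u, v, j, hv, ?_, ?_, ?_, hfu, hfv⟩
    · exact Nat.one_le_iff_ne_zero.2 (Nat.ne_zero_of_lt (Finset.mem_Ioc.1 (hB i hu)).1)
    · rw [hfu, hfv] at h01
      exact (Nat.pow_le_pow_iff_left hk).1 h01
    · rw [← hfu, ← hfv, hs]
  obtain ⟨u₀, v₀, j₀, hv₀, -, huv₀, hs₀, -⟩ := unpack f₀ hf₀
  refine le_trans ?_ (hg j₀ n)
  refine le_trans ?_ (Finset.card_image_le (f := fun v => v ^ k))
  rw [← Set.ncard_coe_finset]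
  refine Set.ncard_le_ncard_of_injOn (fun f => f 1) (fun f hf => ?_) ?_ (Finset.finite_toSet _)
  · obtain ⟨u, v, j, hv, hu, huv, hs, -, h1⟩ := unpack f hf
    have hj : j = j₀ := by
      have hb := Finset.mem_Ioc.1 (hB j hv)
      have hb₀ := Finset.mem_Ioc.1 (hB j₀ hv₀)
      have := not_lt_of_pow_add_pow_eq hk huv hb.2 hb₀.1 (hs.trans hs₀.symm)
      have := not_lt_of_pow_add_pow_eq hk huv₀ hb₀.2 hb.1 (hs₀.trans hs.symm)
      omega
    subst hj
    exact Finset.mem_coe.2 (Finset.mem_image.2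
      ⟨v, Finset.mem_filter.2 ⟨hv, u, hu, huv, hs⟩, h1.symm⟩)
  · intro f hf f' hf' h
    have h1 := hf.2.2
    have h2 := hf'.2.2
    rw [Fin.sum_univ_two] at h1 h2
    simp only at h
    funext i
    fin_cases i <;> simp <;> omega

theorem card_le_countBelow {k : ℕ} (hk : k ≠ 0) {B : ℕ → Finset ℕ} (j : ℕ) {x : ℝ}
    (hx : ∀ v ∈ B j, ((v ^ k : ℕ) : ℝ) ≤ x) :
    (B j).card ≤ countBelow {m | ∃ j, ∃ v ∈ B j, m = v ^ k} x := by
  rw [countBelow, ← Finset.card_image_of_injective (B j) (Nat.pow_left_injective hk),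
    ← Set.ncard_coe_finset]
  refine Set.ncard_le_ncard (fun m hm => ?_) ?_
  · obtain ⟨v, hv, rfl⟩ := Finset.mem_image.1 (Finset.mem_coe.1 hm)
    exact ⟨⟨j, v, hv, rfl⟩, hx v hv⟩
  · exact (Set.finite_Iic ⌊x⌋₊).subset fun a ha => Nat.le_floor ha.2

theorem stmt13 (k : ℕ) (hk : 2 ≤ k) (ε : ℝ) (hε : 0 < ε) :
    ∃ g : ℕ, 1 ≤ g ∧ ∃ A : Set ℕ, A ⊆ kPow k ∧
      (∀ n : ℕ, 1 ≤ n → Rstar A 2 n ≤ g) ∧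
      ∃ c : ℝ, 0 < c ∧ ∃ x0 : ℝ, ∀ x : ℝ, x0 ≤ x →
        c * x ^ (1 / (k : ℝ) - ε) ≤ (countBelow A x : ℝ) := by
  have hk0 : k ≠ 0 := by omega
  have hkR : (2 : ℝ) ≤ k := by exact_mod_cast hk
  set δ : ℝ := min 1 ε with hδ
  have hδ0 : 0 < δ := lt_min one_pos hε
  have hδ1 : δ ≤ 1 := min_le_left _ _
  have hδε : δ ≤ ε := min_le_right _ _
  obtain ⟨g, hg1, c, hc, hblock⟩ := exists_dense_block hk hδ0
  choose B hB hBc hBg using fun j : ℕ => hblock (4 ^ j) (Nat.one_le_pow _ _ (by norm_num))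
  refine ⟨g, hg1, {m | ∃ j, ∃ v ∈ B j, m = v ^ k}, ?_, fun n _ => Rstar_two_le hk0 hB hBg n,
    c / 8 ^ (1 - δ), by positivity, 2 ^ k, fun x hx => ?_⟩
  · rintro m ⟨j, v, hv, rfl⟩
    exact ⟨v, Nat.one_le_iff_ne_zero.2 (Nat.ne_zero_of_lt (Finset.mem_Ioc.1 (hB j hv)).1), rfl⟩
  have hx1 : (1 : ℝ) ≤ x := (one_le_pow₀ (by norm_num)).trans hx
  set y : ℝ := x ^ (1 / (k : ℝ)) with hy
  have hyk : y ^ k = x := by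
    rw [hy, one_div, Real.rpow_inv_natCast_pow (by linarith) hk0]
  have hy0 : 0 ≤ y := by positivity
  have hy2 : 2 ≤ y := le_of_pow_le_pow_left₀ hk0 hy0 (by rwa [hyk])
  obtain ⟨j, hj1, hj2⟩ := exists_nat_pow_near (show 1 ≤ y / 2 by linarith)
    (show (1 : ℝ) < 4 by norm_num)
  have hcnt : (B j).card ≤ countBelow {m | ∃ j, ∃ v ∈ B j, m = v ^ k} x := by
    refine card_le_countBelow hk0 j fun v hv => ?_
    have h1 : (v : ℝ) ≤ 2 * 4 ^ j := by exact_mod_cast (Finset.mem_Ioc.1 (hB j hv)).2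
    rw [← hyk]
    push_cast
    gcongr
    linarith
  have hL : y / 8 ≤ ((4 ^ j : ℕ) : ℝ) := by
    rw [pow_succ] at hj2
    push_cast
    linarith
  calc c / 8 ^ (1 - δ) * x ^ (1 / (k : ℝ) - ε)
      ≤ c / 8 ^ (1 - δ) * x ^ (1 / (k : ℝ) * (1 - δ)) := by
        gcongr
        have : 1 / (k : ℝ) * δ ≤ 1 * δ := by
          gcongr
          rw [div_le_one (by linarith)]
          linarith
        linarith
    _ = c * (y / 8) ^ (1 - δ) := by
        rw [Real.rpow_mul (by linarith), ← hy, Real.div_rpow hy0 (by norm_num)]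
        ring
    _ ≤ c * ((4 ^ j : ℕ) : ℝ) ^ (1 - δ) := by
        gcongr
    _ ≤ (B j).card := hBc j
    _ ≤ _ := by exact_mod_cast hcnt
end

section
/- For every integer k ≥ 2 there exists a positive integer h_0(k), with h_0(k) = O(8^k·k²) (i.e., h_0(k) ≤ D·8^k·k² for an absolute constant D), such that for every integer h ≥ h_0(k) and every ε > 0 there exist a set A ⊆ (ℤ+)^k and constants C > 0 and c > 0 such that R_{A,h}(n) ≤ C for every positive integer n and A(x) ≥ c·x^{1/h − ε} for all sufficiently large x. -/
open Finset in
/-- The divisor bound `d(n) ≪ n ^ ε`. -/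
theorem exists_card_divisors_le (ε : ℝ) (hε : 0 < ε) :
    ∃ K : ℝ, 1 ≤ K ∧ ∀ n : ℕ, n ≠ 0 → (#n.divisors : ℝ) ≤ K * (n : ℝ) ^ ε := by
  obtain ⟨L, hL1, hL⟩ : ∃ L : ℝ, 1 ≤ L ∧ ∀ a : ℕ, (a + 1 : ℝ) ≤ L * ((2 : ℝ) ^ ε) ^ a := by
    have hb : 0 < (2 : ℝ) ^ ε - 1 := by
      have := Real.one_lt_rpow (x := 2) (by norm_num) hε
      linarith
    refine ⟨1 + 1 / ((2 : ℝ) ^ ε - 1), by have := one_div_pos.2 hb; linarith, fun a => ?_⟩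
    have h1 := one_add_mul_le_pow (a := (2 : ℝ) ^ ε - 1) (by linarith) a
    have h2 : (1 : ℝ) ≤ ((2 : ℝ) ^ ε) ^ a := one_le_pow₀ (by linarith)
    have h3 : (a : ℝ) ≤ 1 / ((2 : ℝ) ^ ε - 1) * ((2 : ℝ) ^ ε) ^ a := by
      rw [one_div, inv_mul_eq_div, le_div_iff₀ hb]
      have : 1 + ((2 : ℝ) ^ ε - 1) = 2 ^ ε := by ring
      rw [this] at h1
      linarith
    linarith
  obtain ⟨B, hB⟩ := exists_nat_gt ((2 : ℝ) ^ (1 / ε))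
  refine ⟨L ^ B, one_le_pow₀ hL1, fun n hn => ?_⟩
  have hbig : ∀ p : ℕ, B ≤ p → ∀ a : ℕ, (a + 1 : ℝ) ≤ ((p : ℝ) ^ ε) ^ a := by
    intro p hp a
    have h2 : (2 : ℝ) ≤ (p : ℝ) ^ ε := by
      have : (2 : ℝ) ^ (1 / ε) ≤ p := hB.le.trans (by exact_mod_cast hp)
      calc (2 : ℝ) = ((2 : ℝ) ^ (1 / ε)) ^ ε := by
            rw [← Real.rpow_mul (by norm_num), one_div, inv_mul_cancel₀ hε.ne', Real.rpow_one]
        _ ≤ _ := Real.rpow_le_rpow (by positivity) this hε.le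
    calc (a + 1 : ℝ) ≤ 2 ^ a := by exact_mod_cast Nat.lt_two_pow_self
      _ ≤ _ := pow_le_pow_left₀ (by norm_num) h2 a
  rw [Nat.card_divisors hn]
  have hn' : (n : ℝ) ^ ε = ∏ p ∈ n.primeFactors, ((p : ℝ) ^ ε) ^ (n.factorization p) := by
    conv_lhs => rw [← Nat.prod_factorization_pow_eq_self hn]
    rw [Finsupp.prod, Nat.support_factorization]
    push_cast
    rw [← Real.finsetProd_rpow _ _ (fun i _ => by positivity)]
    refine prod_congr rfl fun p _ => ?_
    rw [← Real.rpow_natCast, ← Real.rpow_mul (by positivity), ← Real.rpow_natCast,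
      ← Real.rpow_mul (by positivity), mul_comm]
  rw [hn']
  push_cast
  have hle : ∀ p ∈ n.primeFactors, ((n.factorization p : ℝ) + 1) ≤
      (if p < B then L else 1) * ((p : ℝ) ^ ε) ^ (n.factorization p) := by
    intro p hp
    split_ifs with h
    · refine (hL _).trans ?_
      have : (2 : ℝ) ≤ p := by exact_mod_cast (Nat.prime_of_mem_primeFactors hp).two_le
      gcongr
    · rw [one_mul]
      exact hbig p (not_lt.1 h) _
  refine (prod_le_prod (fun p _ => by positivity) hle).trans ?_
  rw [prod_mul_distrib]
  refine mul_le_mul_of_nonneg_right ?_ (prod_nonneg fun p _ => by positivity)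
  rw [prod_ite, prod_const, prod_const_one, mul_one]
  refine pow_le_pow_right₀ hL1 ?_
  calc #(n.primeFactors.filter (· < B)) ≤ #(range B) := card_le_card fun p hp => by
        simpa using (mem_filter.1 hp).2
    _ = B := card_range B

section

open Polynomial Finset

/-- The forward difference `P(X + h) - P(X)`. -/
noncomputable def polyDiff (h : ℤ) (P : ℤ[X]) : ℤ[X] := P.comp (X + C h) - P

/-- The phases produced by `j` Weyl differencing steps applied to `P` on the set `I`. -/
noncomputable def weylPhases (N : ℕ) : ℕ → ℤ[X] → Finset ℤ → Multiset ℤ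
  | 0, P, I => I.val.map fun x => P.eval x
  | j + 1, P, I => (Ioo (-N : ℤ) N).val.bind fun h =>
      weylPhases N j (polyDiff h P) (I.filter fun x => x + h ∈ I)

/-- The exponential sum of `P` over `I` at the frequency `a / q`. -/
noncomputable def charSum (q : ℕ) [NeZero q] (P : ℤ[X]) (I : Finset ℤ) (a : ZMod q) : ℂ :=
  ∑ x ∈ I, ZMod.stdAddChar (a * ((P.eval x : ℤ) : ZMod q))

/-- The exponential sum over a multiset of phases. -/
noncomputable def phaseSum (q : ℕ) [NeZero q] (M : Multiset ℤ) (a : ZMod q) : ℂ :=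
  (M.map fun n : ℤ => ZMod.stdAddChar (a * (n : ZMod q))).sum

theorem polyDiff_eval (h x : ℤ) (P : ℤ[X]) : (polyDiff h P).eval x = P.eval (x + h) - P.eval x := by
  simp [polyDiff]

theorem phaseSum_weylPhases_zero (q : ℕ) [NeZero q] (N : ℕ) (P : ℤ[X]) (I : Finset ℤ)
    (a : ZMod q) : phaseSum q (weylPhases N 0 P I) a = charSum q P I a := by
  rw [phaseSum, weylPhases, Multiset.map_map]
  rfl

theorem phaseSum_weylPhases_succ (q : ℕ) [NeZero q] (N j : ℕ) (P : ℤ[X]) (I : Finset ℤ)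
    (a : ZMod q) : phaseSum q (weylPhases N (j + 1) P I) a =
      ∑ h ∈ Ioo (-N : ℤ) N,
        phaseSum q (weylPhases N j (polyDiff h P) (I.filter fun x => x + h ∈ I)) a := by
  rw [phaseSum, weylPhases, Multiset.map_bind, Multiset.sum_bind]
  rfl

theorem norm_charSum_sq (q : ℕ) [NeZero q] (N : ℕ) (P : ℤ[X]) (I : Finset ℤ)
    (hI : I ⊆ Ico 0 (N : ℤ)) (a : ZMod q) :
    ((‖charSum q P I a‖ ^ 2 : ℝ) : ℂ) =
      ∑ h ∈ Ioo (-N : ℤ) N, charSum q (polyDiff h P) (I.filter fun x => x + h ∈ I) a := by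
  have h1 : ((‖charSum q P I a‖ ^ 2 : ℝ) : ℂ) =
      ∑ x ∈ I, ∑ y ∈ I, ZMod.stdAddChar (a * ((P.eval y - P.eval x : ℤ) : ZMod q)) := by
    push_cast
    rw [← Complex.conj_mul', charSum, map_sum, sum_mul_sum]
    refine sum_congr rfl fun x _ => sum_congr rfl fun y _ => ?_
    rw [← AddChar.map_neg_eq_conj, ← AddChar.map_add_eq_mul]
    congr 1
    ring
  rw [h1]
  have h2 : ∀ x ∈ I, ∑ y ∈ I, ZMod.stdAddChar (a * ((P.eval y - P.eval x : ℤ) : ZMod q)) =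
      ∑ h ∈ Ioo (-N : ℤ) N, if x + h ∈ I then
        ZMod.stdAddChar (a * ((P.eval (x + h) - P.eval x : ℤ) : ZMod q)) else 0 := by
    intro x hx
    rw [← sum_filter]
    refine sum_nbij' (fun y => y - x) (fun h => x + h) ?_ ?_ ?_ ?_ ?_
    · intro y hy
      have h3 := mem_Ico.1 (hI hx)
      have h4 := mem_Ico.1 (hI hy)
      simp only [mem_filter, mem_Ioo, add_sub_cancel]
      exact ⟨⟨by omega, by omega⟩, hy⟩
    · intro h hh
      exact (mem_filter.1 hh).2
    · intro y _
      ring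
    · intro h _
      ring
    · intro y _
      simp
  rw [sum_congr rfl h2, sum_comm]
  refine sum_congr rfl fun h _ => ?_
  rw [charSum, sum_filter]
  simp only [polyDiff_eval]

theorem norm_charSum_pow_le (q : ℕ) [NeZero q] (N j : ℕ) (P : ℤ[X]) (I : Finset ℤ)
    (hI : I ⊆ Ico 0 (N : ℤ)) (a : ZMod q) :
    ‖charSum q P I a‖ ^ 2 ^ (j + 1) ≤
      (2 * N : ℝ) ^ (2 ^ (j + 1) - (j + 2)) * (phaseSum q (weylPhases N (j + 1) P I) a).re := by
  induction j generalizing P I with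
  | zero =>
    have := norm_charSum_sq q N P I hI a
    rw [phaseSum_weylPhases_succ]
    simp only [phaseSum_weylPhases_zero]
    rw [← this, Complex.ofReal_re]
    simp
  | succ j ih =>
    have hc : (#(Ioo (-N : ℤ) N) : ℝ) ≤ 2 * N := by
      rw [Int.card_Ioo]
      have : ((N : ℤ) - -N - 1).toNat ≤ 2 * N := by omega
      exact_mod_cast this
    have h2j : j + 2 ≤ 2 ^ (j + 1) := by
      have := @Nat.lt_two_pow_self (j + 1)
      omega
    have h0 : (0 : ℝ) ≤ 2 * N := by positivity
    have h1 : ‖charSum q P I a‖ ^ 2 ≤ ∑ h ∈ Ioo (-N : ℤ) N,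
        ‖charSum q (polyDiff h P) (I.filter fun x => x + h ∈ I) a‖ := by
      have := norm_charSum_sq q N P I hI a
      calc ‖charSum q P I a‖ ^ 2 = ‖((‖charSum q P I a‖ ^ 2 : ℝ) : ℂ)‖ := by
            rw [Complex.norm_real, Real.norm_of_nonneg (by positivity)]
        _ ≤ _ := by rw [this]; exact norm_sum_le _ _
    calc ‖charSum q P I a‖ ^ 2 ^ (j + 1 + 1) = (‖charSum q P I a‖ ^ 2) ^ 2 ^ (j + 1) := by
          rw [← pow_mul, ← pow_succ']
      _ ≤ (∑ h ∈ Ioo (-N : ℤ) N,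
        ‖charSum q (polyDiff h P) (I.filter fun x => x + h ∈ I) a‖) ^ 2 ^ (j + 1) := by gcongr
      _ ≤ (#(Ioo (-N : ℤ) N) : ℝ) ^ (2 ^ (j + 1) - 1) * ∑ h ∈ Ioo (-N : ℤ) N,
        ‖charSum q (polyDiff h P) (I.filter fun x => x + h ∈ I) a‖ ^ 2 ^ (j + 1) := by
          obtain ⟨m, hm⟩ : ∃ m, 2 ^ (j + 1) = m + 1 := ⟨2 ^ (j + 1) - 1, by omega⟩
          rw [hm, Nat.add_sub_cancel]
          exact pow_sum_le_card_mul_sum_pow (fun _ _ => norm_nonneg _) m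
      _ ≤ (2 * N : ℝ) ^ (2 ^ (j + 1) - 1) * ∑ h ∈ Ioo (-N : ℤ) N,
        ((2 * N : ℝ) ^ (2 ^ (j + 1) - (j + 2)) * (phaseSum q (weylPhases N (j + 1) (polyDiff h P)
          (I.filter fun x => x + h ∈ I)) a).re) := by
          gcongr with h _
          exact ih _ _ ((filter_subset _ _).trans hI)
      _ = _ := by
          rw [phaseSum_weylPhases_succ, Complex.re_sum, ← mul_sum, ← mul_assoc, ← pow_add]
          congr 2
          have : 2 ^ (j + 1 + 1) = 2 ^ (j + 1) + 2 ^ (j + 1) := by ring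
          omega

theorem natDegree_polyDiff {h : ℤ} (hh : h ≠ 0) {P : ℤ[X]} {d : ℕ} (hP : P.natDegree = d + 1) :
    (polyDiff h P).natDegree = d := by
  have hP0 : P ≠ 0 := by
    rintro rfl
    simp at hP
  have hT : polyDiff h P = taylor h P - P := by rw [polyDiff, taylor_apply]
  have hlt : (polyDiff h P).degree < (d + 1 : ℕ) := by
    rw [hT, ← hP, ← degree_eq_natDegree hP0, ← degree_taylor P h]
    refine degree_sub_lt_left (degree_taylor P h) ?_ (leadingCoeff_taylor ..)
    rwa [Ne, ← degree_eq_bot, degree_taylor, degree_eq_bot]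
  refine natDegree_eq_of_le_of_coeff_ne_zero ?_ ?_
  · rw [natDegree_le_iff_degree_le]
    exact Order.le_of_lt_succ hlt
  · have h1 : (hasseDeriv d P).natDegree ≤ 1 := by
      have := natDegree_hasseDeriv_le P d
      omega
    rw [hT, coeff_sub, taylor_coeff, eq_X_add_C_of_natDegree_le_one h1]
    simp only [hasseDeriv_coeff, eval_add, eval_mul, eval_C, eval_X]
    have h2 : P.coeff (1 + d) ≠ 0 := by
      rw [add_comm, ← hP]
      exact leadingCoeff_ne_zero.2 hP0
    have h3 : ((1 + d).choose d : ℤ) ≠ 0 := by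
      exact_mod_cast (Nat.choose_pos (by omega)).ne'
    simp only [zero_add, Nat.choose_self, Nat.cast_one, one_mul, add_sub_cancel_right]
    positivity

theorem card_weylPhases_le (N j : ℕ) (P : ℤ[X]) (I : Finset ℤ) :
    (weylPhases N j P I).card ≤ (2 * N) ^ j * #I := by
  induction j generalizing P I with
  | zero => simp [weylPhases]
  | succ j ih =>
    rw [weylPhases, Multiset.card_bind]
    change ∑ h ∈ Ioo (-N : ℤ) N, _ ≤ _
    calc _ ≤ ∑ h ∈ Ioo (-N : ℤ) N, (2 * N) ^ j * #I := by
          refine sum_le_sum fun h _ => (ih _ _).trans ?_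
          exact Nat.mul_le_mul_left _ (card_le_card (filter_subset _ _))
      _ ≤ 2 * N * ((2 * N) ^ j * #I) := by
          rw [sum_const, smul_eq_mul, Int.card_Ioo]
          exact Nat.mul_le_mul_right _ (by omega)
      _ = _ := by ring

theorem dvd_of_mem_weylPhases {N j : ℕ} {P : ℤ[X]} {I : Finset ℤ} {d : ℤ}
    (hd : ∀ y, d ∣ P.eval y) {n : ℤ} (hn : n ∈ weylPhases N j P I) : d ∣ n := by
  induction j generalizing P I with
  | zero =>
    obtain ⟨x, -, rfl⟩ := Multiset.mem_map.1 hn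
    exact hd x
  | succ j ih =>
    obtain ⟨h, -, hm⟩ := Multiset.mem_bind.1 hn
    refine ih (fun y => ?_) hm
    rw [polyDiff_eval]
    exact dvd_sub (hd _) (hd _)

theorem abs_le_of_mem_weylPhases {N j : ℕ} {P : ℤ[X]} {I : Finset ℤ} {B : ℤ}
    (hB : ∀ x ∈ I, |P.eval x| ≤ B) {n : ℤ} (hn : n ∈ weylPhases N j P I) : |n| ≤ 2 ^ j * B := by
  induction j generalizing P I B with
  | zero =>
    obtain ⟨x, hx, rfl⟩ := Multiset.mem_map.1 hn
    simpa using hB x hx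
  | succ j ih =>
    obtain ⟨h, -, hm⟩ := Multiset.mem_bind.1 hn
    have := ih (B := 2 * B) (fun x hx => ?_) hm
    · rw [pow_succ, mul_assoc]
      exact this
    · rw [mem_filter] at hx
      rw [polyDiff_eval]
      calc _ ≤ |P.eval (x + h)| + |P.eval x| := abs_sub _ _
        _ ≤ _ := by linarith [hB _ hx.1, hB _ hx.2]

theorem dvd_polyDiff_eval (h y : ℤ) (P : ℤ[X]) : h ∣ (polyDiff h P).eval y := by
  rw [polyDiff_eval]
  simpa using sub_dvd_eval_sub (y + h) y P

theorem count_weylPhases_zero_le (N : ℕ) (P : ℤ[X]) (I : Finset ℤ) (hP : P.natDegree ≠ 0)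
    (n : ℤ) : (weylPhases N 0 P I).count n ≤ P.natDegree := by
  have h0 : P - C n ≠ 0 := by
    intro h
    rw [sub_eq_zero.1 h] at hP
    simp at hP
  rw [weylPhases, Multiset.count_map]
  change #(I.filter fun x => n = P.eval x) ≤ _
  calc _ ≤ #((P - C n).roots.toFinset) := card_le_card fun x hx => by
        rw [mem_filter] at hx
        rw [Multiset.mem_toFinset, mem_roots h0]
        simp [← hx.2]
    _ ≤ (P - C n).roots.card := Multiset.toFinset_card_le _
    _ ≤ (P - C n).natDegree := card_roots' _
    _ = _ := natDegree_sub_C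

theorem card_filter_dvd_le {n : ℤ} (hn : n ≠ 0) (s : Finset ℤ) :
    #(s.filter (· ∣ n)) ≤ 2 * #n.natAbs.divisors := by
  calc _ ≤ #(n.natAbs.divisors.image (fun m : ℕ => (m : ℤ)) ∪
        n.natAbs.divisors.image (fun m : ℕ => -(m : ℤ))) := card_le_card fun x hx => by
        have h1 : x.natAbs ∣ n.natAbs := Int.natAbs_dvd_natAbs.2 (mem_filter.1 hx).2
        have h2 : x.natAbs ∈ n.natAbs.divisors :=
          Nat.mem_divisors.2 ⟨h1, Int.natAbs_ne_zero.2 hn⟩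
        rw [mem_union, mem_image, mem_image]
        rcases Int.natAbs_eq x with h | h
        · exact Or.inl ⟨_, h2, h.symm⟩
        · exact Or.inr ⟨_, h2, h.symm⟩
    _ ≤ _ := by
        refine (card_union_le _ _).trans ?_
        rw [two_mul]
        exact add_le_add card_image_le card_image_le

theorem count_weylPhases_le (N j K : ℕ) (P : ℤ[X]) (I : Finset ℤ) (hj : j < P.natDegree)
    (hK : P.natDegree ≤ K) {n : ℤ} (hn : n ≠ 0) :
    (weylPhases N j P I).count n ≤ K * (2 * #n.natAbs.divisors) ^ j := by
  induction j generalizing P I with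
  | zero =>
    rw [pow_zero, mul_one]
    exact (count_weylPhases_zero_le N P I (by omega) n).trans hK
  | succ j ih =>
    rw [weylPhases, Multiset.count_bind]
    change ∑ h ∈ Ioo (-N : ℤ) N, _ ≤ _
    calc _ ≤ ∑ h ∈ Ioo (-N : ℤ) N, if h ∣ n then K * (2 * #n.natAbs.divisors) ^ j else 0 := by
          refine sum_le_sum fun h _ => ?_
          split_ifs with hd
          · have h0 : h ≠ 0 := by
              rintro rfl
              exact hn (zero_dvd_iff.1 hd)
            obtain ⟨d, hd'⟩ : ∃ d, P.natDegree = d + 1 := ⟨P.natDegree - 1, by omega⟩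
            have := natDegree_polyDiff h0 hd'
            exact ih _ _ (by omega) (by omega)
          · refine (Multiset.count_eq_zero.2 fun hm => hd ?_).le
            exact dvd_of_mem_weylPhases (fun y => dvd_polyDiff_eval h y P) hm
      _ = #((Ioo (-N : ℤ) N).filter (· ∣ n)) * (K * (2 * #n.natAbs.divisors) ^ j) := by
          rw [← sum_filter, sum_const, smul_eq_mul]
      _ ≤ (2 * #n.natAbs.divisors) * (K * (2 * #n.natAbs.divisors) ^ j) :=
          Nat.mul_le_mul_right _ (card_filter_dvd_le hn _)
      _ = _ := by ring

theorem count_zero_weylPhases_le (N j K : ℕ) (P : ℤ[X]) (I : Finset ℤ) (hj : j < P.natDegree)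
    (hK : P.natDegree ≤ K) (hI : #I ≤ N) :
    (weylPhases N j P I).count 0 ≤ (K + j) * (2 * N) ^ j := by
  induction j generalizing P I with
  | zero =>
    rw [pow_zero, mul_one]
    exact (count_weylPhases_zero_le N P I (by omega) 0).trans hK
  | succ j ih =>
    rw [weylPhases, Multiset.count_bind]
    change ∑ h ∈ Ioo (-N : ℤ) N, _ ≤ _
    calc _ ≤ ∑ h ∈ Ioo (-N : ℤ) N,
          ((K + j) * (2 * N) ^ j + if h = 0 then (2 * N) ^ j * N else 0) := by
          refine sum_le_sum fun h _ => ?_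
          have hc : #(I.filter fun x => x + h ∈ I) ≤ N := (card_le_card (filter_subset _ _)).trans hI
          split_ifs with h0
          · refine (Multiset.count_le_card _ _).trans ((card_weylPhases_le ..).trans ?_)
            refine le_add_left (Nat.mul_le_mul_left _ hc)
          · obtain ⟨d, hd'⟩ : ∃ d, P.natDegree = d + 1 := ⟨P.natDegree - 1, by omega⟩
            have := natDegree_polyDiff h0 hd'
            exact ih _ _ (by omega) (by omega) hc
      _ ≤ (2 * N) * ((K + j) * (2 * N) ^ j) + (2 * N) ^ j * N := by
          rw [sum_add_distrib, sum_const, smul_eq_mul, Int.card_Ioo]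
          refine add_le_add (Nat.mul_le_mul_right _ (by omega)) ?_
          rw [sum_ite_eq']
          split_ifs <;> simp
      _ ≤ (2 * N) * ((K + j) * (2 * N) ^ j) + (2 * N) ^ j * (2 * N) := by
          gcongr
          omega
      _ = _ := by ring

/-- `r` is a sum of additive characters `a ↦ e(a c / q)` with nonnegative integer multiplicities. -/
def IsCharComb (q : ℕ) [NeZero q] (r : ZMod q → ℂ) : Prop :=
  ∃ (ι : Type) (_ : Fintype ι) (c : ι → ZMod q), ∀ a, r a = ∑ i, ZMod.stdAddChar (a * c i)

theorem IsCharComb.one (q : ℕ) [NeZero q] : IsCharComb q fun _ => 1 :=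
  ⟨Unit, inferInstance, fun _ => 0, by simp⟩

theorem IsCharComb.mul {q : ℕ} [NeZero q] {r s : ZMod q → ℂ} (hr : IsCharComb q r)
    (hs : IsCharComb q s) : IsCharComb q fun a => r a * s a := by
  obtain ⟨ι, _, c, hc⟩ := hr
  obtain ⟨κ, _, d, hd⟩ := hs
  refine ⟨ι × κ, inferInstance, fun p => c p.1 + d p.2, fun a => ?_⟩
  change r a * s a = _
  rw [hc, hd, sum_mul_sum, Fintype.sum_prod_type]
  simp only [mul_add, AddChar.map_add_eq_mul]

theorem IsCharComb.pow {q : ℕ} [NeZero q] {r : ZMod q → ℂ} (hr : IsCharComb q r) (m : ℕ) :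
    IsCharComb q fun a => r a ^ m := by
  induction m with
  | zero => simpa using IsCharComb.one q
  | succ m ih => simpa only [pow_succ] using ih.mul hr

theorem isCharComb_norm_charSum_sq (q : ℕ) [NeZero q] (P : ℤ[X]) (I : Finset ℤ) :
    IsCharComb q fun a => ((‖charSum q P I a‖ ^ 2 : ℝ) : ℂ) := by
  have h1 : IsCharComb q (charSum q P I) :=
    ⟨I, inferInstance, fun x => ((P.eval (x : ℤ) : ℤ) : ZMod q), fun a =>
      (sum_coe_sort I fun x => ZMod.stdAddChar (a * ((P.eval x : ℤ) : ZMod q))).symm⟩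
  have h2 : IsCharComb q fun a => (starRingEnd ℂ) (charSum q P I a) :=
    ⟨I, inferInstance, fun x => -((P.eval (x : ℤ) : ℤ) : ZMod q), fun a => by
      beta_reduce
      rw [charSum, map_sum, ← sum_coe_sort]
      simp only [← AddChar.map_neg_eq_conj, mul_neg]⟩
  convert h2.mul h1 using 2 with a
  rw [Complex.conj_mul']
  push_cast
  rfl

theorem sum_stdAddChar_mul (q : ℕ) [NeZero q] (b : ZMod q) :
    ∑ a : ZMod q, (ZMod.stdAddChar (a * b) : ℂ) = if b = 0 then (q : ℂ) else 0 := by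
  rw [AddChar.sum_mulShift b (ZMod.isPrimitive_stdAddChar q), ZMod.card]
  push_cast
  rfl

theorem sum_mul_phaseSum_le (q : ℕ) [NeZero q] (r : ZMod q → ℝ)
    (hr : IsCharComb q fun a => (r a : ℂ)) (M : Multiset ℤ) (B : ℤ) (hB : 2 * B < q)
    (hM : ∀ n ∈ M, |n| ≤ B) (R₀ R₁ : ℝ) (hR₁ : 0 ≤ R₁) (h0 : (M.count 0 : ℝ) ≤ R₀)
    (h1 : ∀ n ∈ M, n ≠ 0 → (M.count n : ℝ) ≤ R₁) :
    ∑ a, r a * (phaseSum q M a).re ≤ R₀ * ∑ a, r a + q * R₁ * r 0 := by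
  obtain ⟨ι, _, c, hc⟩ := hr
  beta_reduce at hc
  set X : ι → ℕ := fun i => ∑ n ∈ M.toFinset, if c i + (n : ZMod q) = 0 then M.count n else 0
    with hX
  have hR₀ : 0 ≤ R₀ := le_trans (by positivity) h0
  have hXle : ∀ i, (X i : ℝ) ≤ (if c i = 0 then R₀ else 0) + R₁ := by
    intro i
    by_cases hex : ∃ n₀ ∈ M, c i + (n₀ : ZMod q) = 0
    · obtain ⟨n₀, hn₀, hcn⟩ := hex
      have huniq : ∀ n ∈ M, c i + (n : ZMod q) = 0 → n = n₀ := by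
        intro n hn hcn'
        have h3 : ((n - n₀ : ℤ) : ZMod q) = 0 := by
          push_cast
          linear_combination hcn' - hcn
        rw [ZMod.intCast_zmod_eq_zero_iff_dvd] at h3
        have h4 := abs_le.1 (hM n hn)
        have h5 := abs_le.1 (hM n₀ hn₀)
        have := Int.eq_zero_of_abs_lt_dvd h3 (abs_lt.2 ⟨by linarith, by linarith⟩)
        linarith
      have hXi : X i = M.count n₀ := by
        rw [hX]
        simp only
        rw [sum_eq_single n₀, if_pos hcn]
        · intro n hn hne
          exact if_neg fun h => hne (huniq n (Multiset.mem_toFinset.1 hn) h)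
        · intro h
          exact absurd (Multiset.mem_toFinset.2 hn₀) h
      rw [hXi]
      by_cases hn : n₀ = 0
      · subst hn
        have : c i = 0 := by simpa using hcn
        rw [if_pos this]
        linarith
      · have := h1 n₀ hn₀ hn
        split_ifs <;> linarith
    · have : X i = 0 := by
        rw [hX]
        refine sum_eq_zero fun n hn => if_neg fun h => hex ⟨n, Multiset.mem_toFinset.1 hn, h⟩
      rw [this]
      split_ifs <;> simp <;> linarith
  have hsum : (∑ a, (r a : ℂ) * phaseSum q M a) = q * ∑ i, (X i : ℂ) := by
    have e1 : ∀ a, (r a : ℂ) * phaseSum q M a = ∑ i, ∑ n ∈ M.toFinset,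
        (M.count n : ℂ) * ZMod.stdAddChar (a * (c i + (n : ZMod q))) := by
      intro a
      rw [hc, phaseSum, Finset.sum_multiset_map_count, sum_mul_sum]
      refine sum_congr rfl fun i _ => sum_congr rfl fun n _ => ?_
      rw [mul_add, AddChar.map_add_eq_mul, nsmul_eq_mul]
      ring
    simp only [e1]
    rw [sum_comm, mul_sum]
    refine sum_congr rfl fun i _ => ?_
    rw [sum_comm, hX]
    push_cast
    rw [mul_sum]
    refine sum_congr rfl fun n _ => ?_
    rw [← mul_sum, sum_stdAddChar_mul]
    split_ifs <;> simp [mul_comm]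
  have hre : ∑ a, r a * (phaseSum q M a).re = q * ∑ i, (X i : ℝ) := by
    have := congrArg Complex.re hsum
    rw [Complex.re_sum] at this
    simp only [Complex.re_ofReal_mul] at this
    rw [this, ← Nat.cast_sum, ← Nat.cast_mul, Complex.natCast_re]
    push_cast
    rfl
  have hr0 : r 0 = Fintype.card ι := by
    have := hc 0
    simp only [zero_mul, AddChar.map_zero_eq_one, sum_const, card_univ, nsmul_eq_mul, mul_one] at this
    exact_mod_cast this
  have hrs : ∑ a, r a = q * ∑ i, (if c i = 0 then (1 : ℝ) else 0) := by
    have : (∑ a, (r a : ℂ)) = q * ∑ i, (if c i = 0 then (1 : ℂ) else 0) := by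
      simp only [hc]
      rw [sum_comm, mul_sum]
      refine sum_congr rfl fun i _ => ?_
      rw [sum_stdAddChar_mul]
      split_ifs <;> simp
    have h' : (∑ i, (if c i = 0 then (1 : ℂ) else 0)) =
        ((∑ i, (if c i = 0 then (1 : ℝ) else 0) : ℝ) : ℂ) := by
      rw [Complex.ofReal_sum]
      exact sum_congr rfl fun i _ => by split_ifs <;> simp
    rw [h'] at this
    exact_mod_cast this
  rw [hre, hrs, hr0]
  calc (q : ℝ) * ∑ i, (X i : ℝ) ≤ q * ∑ i, ((if c i = 0 then R₀ else 0) + R₁) := by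
        gcongr with i
        exact hXle i
    _ = q * (R₀ * ∑ i, (if c i = 0 then (1 : ℝ) else 0) + R₁ * Fintype.card ι) := by
        rw [sum_add_distrib, sum_const, card_univ, nsmul_eq_mul, mul_sum]
        simp only [mul_ite, mul_one, mul_zero]
        ring
    _ = _ := by ring

theorem exists_divisor_power_bound (k : ℕ) (hk : 1 ≤ k) (ε : ℝ) (hε : 0 < ε) :
    ∃ C : ℝ, 1 ≤ C ∧ ∀ N j : ℕ, 1 ≤ N → j ≤ k → ∀ n : ℤ, n ≠ 0 → |n| ≤ 2 ^ k * (N : ℤ) ^ k →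
      (k * (2 * #n.natAbs.divisors) ^ j : ℝ) ≤ C * (N : ℝ) ^ ε := by
  have hk0 : (0 : ℝ) < k := by exact_mod_cast hk
  have hk1 : (1 : ℝ) ≤ k := by exact_mod_cast hk
  obtain ⟨K, hK1, hK⟩ := exists_card_divisors_le (ε / k ^ 2) (by positivity)
  refine ⟨k * (2 * K) ^ k * 2 ^ ε, ?_, ?_⟩
  · have h1 : (1 : ℝ) ≤ (2 * K) ^ k := one_le_pow₀ (by linarith)
    have h2 : (1 : ℝ) ≤ 2 ^ ε := Real.one_le_rpow (by norm_num) hε.le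
    exact one_le_mul_of_one_le_of_one_le (one_le_mul_of_one_le_of_one_le hk1 h1) h2
  · intro N j hN hj n hn hnN
    have hn0 : n.natAbs ≠ 0 := Int.natAbs_ne_zero.2 hn
    have hd1 : (1 : ℝ) ≤ #n.natAbs.divisors := by
      exact_mod_cast card_pos.2 ⟨1, Nat.one_mem_divisors.2 hn0⟩
    have hnr : (n.natAbs : ℝ) ≤ (2 * N : ℝ) ^ k := by
      have : (n.natAbs : ℤ) ≤ (2 * N : ℤ) ^ k := by
        rw [Int.natCast_natAbs, mul_pow]
        exact hnN
      exact_mod_cast this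
    calc (k * (2 * #n.natAbs.divisors) ^ j : ℝ) ≤ k * (2 * #n.natAbs.divisors) ^ k := by
          gcongr
          linarith
      _ ≤ k * (2 * (K * ((2 * N : ℝ) ^ k) ^ (ε / k ^ 2))) ^ k := by
          gcongr
          refine (hK _ hn0).trans ?_
          gcongr
      _ = k * (2 * K) ^ k * (2 * N : ℝ) ^ ε := by
          have : (((2 * N : ℝ) ^ k) ^ (ε / k ^ 2)) ^ k = (2 * N : ℝ) ^ ε := by
            rw [← Real.rpow_natCast, ← Real.rpow_natCast, ← Real.rpow_mul (by positivity),
              ← Real.rpow_mul (by positivity)]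
            congr 1
            field_simp
          rw [← mul_assoc, mul_pow _ _ k, this]
          ring
      _ = _ := by
          rw [Real.mul_rpow (by norm_num) (by positivity)]
          ring

/-- **Hua's lemma**, for the moments over the frequencies `a / q` with `q` large. -/
theorem hua_lemma (k : ℕ) (hk : 2 ≤ k) (ε : ℝ) (hε : 0 < ε) (j : ℕ) (hj1 : 1 ≤ j) (hjk : j ≤ k) :
    ∃ C : ℝ, 1 ≤ C ∧ ∀ (N : ℕ), 1 ≤ N → ∀ (q : ℕ) [NeZero q], 2 * (2 ^ k * N ^ k) < q →
      ∀ I : Finset ℤ, I ⊆ Ico 0 (N : ℤ) →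
        ∑ a : ZMod q, ‖charSum q (X ^ k) I a‖ ^ 2 ^ j ≤ q * C * (N : ℝ) ^ (2 ^ j - j) * (N : ℝ) ^ ε := by
  obtain ⟨C₁, hC₁, hdiv⟩ := exists_divisor_power_bound k (by omega) ε hε
  have key : ∀ i : ℕ, i < k → ∀ (N : ℕ), 1 ≤ N → ∀ (q : ℕ) [NeZero q], 2 * (2 ^ k * N ^ k) < q →
      ∀ I : Finset ℤ, I ⊆ Ico 0 (N : ℤ) → ∀ r : ZMod q → ℝ,
      (IsCharComb q fun a => (r a : ℂ)) → ∑ a, r a * (phaseSum q (weylPhases N i (X ^ k) I) a).re ≤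
        ((k + i) * (2 * N) ^ i : ℝ) * ∑ a, r a + q * (C₁ * (N : ℝ) ^ ε) * r 0 := by
    intro i hi N hN q _ hq I hI r hr
    have habs : ∀ n ∈ weylPhases N i (X ^ k) I, |n| ≤ 2 ^ k * (N : ℤ) ^ k := by
      intro n hn
      refine (abs_le_of_mem_weylPhases (B := (N : ℤ) ^ k) (fun x hx => ?_) hn).trans ?_
      · have := mem_Ico.1 (hI hx)
        rw [eval_pow, eval_X, abs_pow, abs_of_nonneg this.1]
        exact pow_le_pow_left₀ this.1 this.2.le _
      · gcongr
        norm_num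
    refine sum_mul_phaseSum_le q r hr _ (2 ^ k * (N : ℤ) ^ k) (by exact_mod_cast hq) habs _ _
      (by positivity) ?_ ?_
    · have hc : #I ≤ N := by simpa using card_le_card hI
      have := count_zero_weylPhases_le N i k (X ^ k) I (by simpa using hi) (by simp) hc
      exact_mod_cast this
    · intro n hn hn0
      refine le_trans ?_ (hdiv N i hN hi.le n hn0 (habs n hn))
      have := count_weylPhases_le N i k (X ^ k) I (by simpa using hi) (by simp) hn0
      exact_mod_cast this
  induction j, hj1 using Nat.le_induction with
  | base =>
    refine ⟨(k + 1) * 2 + C₁, by have : (0 : ℝ) ≤ k := by positivity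
                                 linarith, fun N hN q _ hq I hI => ?_⟩
    have hN1 : (1 : ℝ) ≤ N := by exact_mod_cast hN
    have hNε : (1 : ℝ) ≤ (N : ℝ) ^ ε := Real.one_le_rpow hN1 hε.le
    calc ∑ a : ZMod q, ‖charSum q (X ^ k) I a‖ ^ 2 ^ 1
        ≤ ∑ a : ZMod q, 1 * (phaseSum q (weylPhases N 1 (X ^ k) I) a).re := by
          refine sum_le_sum fun a _ => ?_
          simpa using norm_charSum_pow_le q N 0 (X ^ k) I hI a
      _ ≤ ((k + (1 : ℕ)) * (2 * N) ^ 1 : ℝ) * ∑ a : ZMod q, (1 : ℝ) +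
          q * (C₁ * (N : ℝ) ^ ε) * 1 := by
          refine key 1 (by omega) N hN q hq I hI (fun _ => 1) ?_
          simpa using IsCharComb.one q
      _ = q * ((k + 1) * 2) * N * 1 + q * C₁ * 1 * N ^ ε := by
          simp only [sum_const, card_univ, ZMod.card, nsmul_eq_mul]
          push_cast
          ring
      _ ≤ q * ((k + 1) * 2) * N * N ^ ε + q * C₁ * N * N ^ ε := by gcongr
      _ = _ := by
          norm_num
          ring
  | succ j hj ih =>
    obtain ⟨C, hC, ih⟩ := ih (by omega)
    refine ⟨2 ^ (2 ^ j - (j + 1)) * ((k + j) * 2 ^ j * C + C₁), ?_, fun N hN q _ hq I hI => ?_⟩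
    · have h1 : (1 : ℝ) ≤ 2 ^ (2 ^ j - (j + 1)) := one_le_pow₀ (by norm_num)
      have h2 : (0 : ℝ) ≤ (k + j) * 2 ^ j * C := by positivity
      exact one_le_mul_of_one_le_of_one_le h1 (by linarith)
    have hN1 : (1 : ℝ) ≤ N := by exact_mod_cast hN
    obtain ⟨i, rfl⟩ : ∃ i, j = i + 1 := ⟨j - 1, by omega⟩
    have h2j : i + 1 + 1 ≤ 2 ^ (i + 1) := Nat.lt_two_pow_self
    have hcomb : IsCharComb q fun a => ((‖charSum q (X ^ k) I a‖ ^ 2 ^ (i + 1) : ℝ) : ℂ) := by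
      have := (isCharComb_norm_charSum_sq q (X ^ k) I).pow (2 ^ i)
      convert this using 2 with a
      push_cast
      rw [← pow_mul, pow_succ']
    have hzero : ‖charSum q (X ^ k) I 0‖ ≤ N := by
      have hc : #I ≤ N := by simpa using card_le_card hI
      simp only [charSum, zero_mul, AddChar.map_zero_eq_one, sum_const, nsmul_eq_mul, mul_one,
        Complex.norm_natCast]
      exact_mod_cast hc
    have hk' := key (i + 1) (by omega) N hN q hq I hI _ hcomb
    have ih' := ih N hN q hq I hI
    calc ∑ a : ZMod q, ‖charSum q (X ^ k) I a‖ ^ 2 ^ (i + 1 + 1)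
        = ∑ a : ZMod q, ‖charSum q (X ^ k) I a‖ ^ 2 ^ (i + 1) *
          ‖charSum q (X ^ k) I a‖ ^ 2 ^ (i + 1) := by
          refine sum_congr rfl fun a _ => ?_
          rw [← pow_add, pow_succ 2 (i + 1), mul_two]
      _ ≤ ∑ a : ZMod q, ‖charSum q (X ^ k) I a‖ ^ 2 ^ (i + 1) *
          ((2 * N : ℝ) ^ (2 ^ (i + 1) - (i + 2)) *
            (phaseSum q (weylPhases N (i + 1) (X ^ k) I) a).re) := by
          gcongr with a
          exact norm_charSum_pow_le q N i (X ^ k) I hI a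
      _ = (2 * N : ℝ) ^ (2 ^ (i + 1) - (i + 2)) * ∑ a : ZMod q,
          ‖charSum q (X ^ k) I a‖ ^ 2 ^ (i + 1) *
            (phaseSum q (weylPhases N (i + 1) (X ^ k) I) a).re := by
          rw [mul_sum]
          exact sum_congr rfl fun a _ => by ring
      _ ≤ (2 * N : ℝ) ^ (2 ^ (i + 1) - (i + 2)) *
          (((k + (i + 1 : ℕ)) * (2 * N) ^ (i + 1) : ℝ) *
            (q * C * (N : ℝ) ^ (2 ^ (i + 1) - (i + 1)) * (N : ℝ) ^ ε) +
          q * (C₁ * (N : ℝ) ^ ε) * (N : ℝ) ^ 2 ^ (i + 1)) := by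
          refine mul_le_mul_of_nonneg_left (hk'.trans ?_) (by positivity)
          gcongr
      _ = _ := by
          have e1 : (N : ℝ) ^ (2 ^ (i + 1 + 1) - (i + 1 + 1)) =
              (N : ℝ) ^ (2 ^ (i + 1) - (i + 2)) * (N : ℝ) ^ 2 ^ (i + 1) := by
            rw [← pow_add]
            congr 1
            have : 2 ^ (i + 1 + 1) = 2 ^ (i + 1) + 2 ^ (i + 1) := by ring
            omega
          have e2 : (N : ℝ) ^ 2 ^ (i + 1) = (N : ℝ) ^ (i + 1) * (N : ℝ) ^ (2 ^ (i + 1) - (i + 1)) := by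
            rw [← pow_add]
            congr 1
            omega
          rw [e1, mul_pow (2 : ℝ) (N : ℝ), mul_pow (2 : ℝ) (N : ℝ), e2]
          ring

end

section

open Finset

theorem sum_mul_pow_le {ι : Type*} (s : Finset ι) (t y : ι → ℝ) (ht : ∀ i ∈ s, 0 < t i)
    (hy : ∀ i ∈ s, 0 ≤ y i) (h : ℕ) (hh : 1 ≤ h) (S : ℝ) (hS : ∑ i ∈ s, t i ≤ S) :
    (∑ i ∈ s, t i * y i) ^ h ≤ S ^ (h - 1) * ∑ i ∈ s, t i * y i ^ h := by
  rcases s.eq_empty_or_nonempty with rfl | hs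
  · simp [show h ≠ 0 by omega]
  set T := ∑ i ∈ s, t i with hT
  have hT0 : 0 < T := sum_pos ht hs
  have h1 := Real.pow_arith_mean_le_arith_mean_pow s (fun i => t i / T) y
    (fun i hi => (div_pos (ht i hi) hT0).le) (by rw [← sum_div, ← hT, div_self hT0.ne']) hy h
  have e1 : ∑ i ∈ s, t i / T * y i = (∑ i ∈ s, t i * y i) / T := by
    rw [sum_div]
    exact sum_congr rfl fun i _ => by ring
  have e2 : ∑ i ∈ s, t i / T * y i ^ h = (∑ i ∈ s, t i * y i ^ h) / T := by
    rw [sum_div]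
    exact sum_congr rfl fun i _ => by ring
  rw [e1, e2, div_pow, div_le_div_iff₀ (by positivity) hT0] at h1
  obtain ⟨m, rfl⟩ : ∃ m, h = m + 1 := ⟨h - 1, by omega⟩
  rw [pow_succ T m, ← mul_assoc, mul_le_mul_iff_left₀ hT0] at h1
  refine h1.trans ?_
  rw [mul_comm, Nat.add_sub_cancel]
  refine mul_le_mul_of_nonneg_right (by gcongr) (sum_nonneg fun i hi => ?_)
  exact mul_nonneg (ht i hi).le (pow_nonneg (hy i hi) _)

/-- The exponential sum of `k`-th powers over the dyadic block `[2 ^ u, 2 ^ (u + 1))`. -/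
noncomputable def dyadicSum (k q : ℕ) [NeZero q] (u : ℕ) (a : ZMod q) : ℂ :=
  ∑ m ∈ Ico (2 ^ u) (2 ^ (u + 1)), ZMod.stdAddChar (a * ((m ^ k : ℕ) : ZMod q))

theorem norm_dyadicSum_le (k q : ℕ) [NeZero q] (u : ℕ) (a : ZMod q) :
    ‖dyadicSum k q u a‖ ≤ 2 ^ u := by
  refine (norm_sum_le _ _).trans ?_
  simp only [AddChar.norm_apply, sum_const, Nat.card_Ico, nsmul_eq_mul, mul_one]
  rw [pow_succ, mul_two, Nat.add_sub_cancel]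
  simp

theorem dyadicSum_eq_charSum (k q : ℕ) [NeZero q] (u : ℕ) (a : ZMod q) :
    dyadicSum k q u a =
      charSum q (Polynomial.X ^ k) ((Ico (2 ^ u) (2 ^ (u + 1))).map Nat.castEmbedding) a := by
  simp [dyadicSum, charSum]

theorem sum_norm_dyadicSum_pow_le (k : ℕ) (hk : 2 ≤ k) (h : ℕ) (hh : 2 ^ k ≤ h) (ε : ℝ)
    (hε : 0 < ε) :
    ∃ C : ℝ, 1 ≤ C ∧ ∀ (u q : ℕ) [NeZero q], 2 * (2 ^ k * (2 ^ (u + 1)) ^ k) < q →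
      ∑ a : ZMod q, ‖dyadicSum k q u a‖ ^ h ≤ q * C * (2 : ℝ) ^ (u * (h - k + ε)) := by
  obtain ⟨C, hC, hH⟩ := hua_lemma k hk ε hε k (by omega) le_rfl
  refine ⟨C * 2 ^ (2 ^ k - k) * 2 ^ ε, ?_, fun u q _ hq => ?_⟩
  · have h1 : (1 : ℝ) ≤ 2 ^ (2 ^ k - k) := one_le_pow₀ (by norm_num)
    have h2 : (1 : ℝ) ≤ 2 ^ ε := Real.one_le_rpow (by norm_num) hε.le
    exact one_le_mul_of_one_le_of_one_le (one_le_mul_of_one_le_of_one_le hC h1) h2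
  have hkk : k ≤ 2 ^ k := Nat.lt_two_pow_self.le
  have h1 := hH (2 ^ (u + 1)) Nat.one_le_two_pow q hq
    ((Ico (2 ^ u) (2 ^ (u + 1))).map Nat.castEmbedding) (by
      intro x hx
      obtain ⟨m, hm, rfl⟩ := mem_map.1 hx
      have := mem_Ico.1 hm
      rw [mem_Ico]
      simp only [Nat.castEmbedding_apply]
      exact ⟨by positivity, by exact_mod_cast this.2⟩)
  simp only [← dyadicSum_eq_charSum] at h1
  calc ∑ a : ZMod q, ‖dyadicSum k q u a‖ ^ h
      = ∑ a : ZMod q, ‖dyadicSum k q u a‖ ^ (h - 2 ^ k) * ‖dyadicSum k q u a‖ ^ 2 ^ k := by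
        refine sum_congr rfl fun a _ => ?_
        rw [← pow_add, Nat.sub_add_cancel hh]
    _ ≤ ∑ a : ZMod q, ((2 : ℝ) ^ u) ^ (h - 2 ^ k) * ‖dyadicSum k q u a‖ ^ 2 ^ k := by
        gcongr with a
        exact norm_dyadicSum_le k q u a
    _ ≤ ((2 : ℝ) ^ u) ^ (h - 2 ^ k) *
        (q * C * ((2 ^ (u + 1) : ℕ) : ℝ) ^ (2 ^ k - k) * ((2 ^ (u + 1) : ℕ) : ℝ) ^ ε) := by
        rw [← mul_sum]
        gcongr
    _ = q * (C * 2 ^ (2 ^ k - k) * 2 ^ ε) *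
        (((2 : ℝ) ^ u) ^ (h - 2 ^ k) * ((2 : ℝ) ^ u) ^ (2 ^ k - k) * ((2 : ℝ) ^ u) ^ ε) := by
        push_cast
        rw [pow_succ (2 : ℝ) u, mul_pow, Real.mul_rpow (by positivity) (by norm_num)]
        ring
    _ = _ := by
        congr 1
        rw [← pow_add, ← Real.rpow_natCast, ← Real.rpow_add (by positivity), ← Real.rpow_natCast 2 u,
          ← Real.rpow_mul (by norm_num)]
        congr 2
        rw [show h - 2 ^ k + (2 ^ k - k) = h - k by omega, Nat.cast_sub (by omega)]

/-- The weighted exponential sum of `k`-th powers of `1 ≤ m < 2 ^ L`, the weight of `m` being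
`2 ^ (σ u)` for `2 ^ u ≤ m < 2 ^ (u + 1)`. -/
noncomputable def weightedSum (k : ℕ) (σ : ℝ) (L q : ℕ) [NeZero q] (a : ZMod q) : ℂ :=
  ∑ m ∈ Ico 1 (2 ^ L), (((2 : ℝ) ^ (σ * Nat.log 2 m) : ℝ) : ℂ) *
    ZMod.stdAddChar (a * ((m ^ k : ℕ) : ZMod q))

theorem weightedSum_eq (k : ℕ) (σ : ℝ) (L q : ℕ) [NeZero q] (a : ZMod q) :
    weightedSum k σ L q a = ∑ u ∈ range L, (((2 : ℝ) ^ (σ * u) : ℝ) : ℂ) * dyadicSum k q u a := by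
  induction L with
  | zero => simp [weightedSum]
  | succ L ih =>
    rw [sum_range_succ, ← ih, weightedSum, weightedSum,
      ← sum_Ico_consecutive _ (Nat.one_le_two_pow (n := L))
        (Nat.pow_le_pow_right (by norm_num) L.le_succ)]
    congr 1
    rw [dyadicSum, mul_sum]
    refine sum_congr rfl fun m hm => ?_
    have := mem_Ico.1 hm
    rw [Nat.log_eq_of_pow_le_of_lt_pow this.1 this.2]

theorem sum_norm_weightedSum_pow_le (k : ℕ) (hk : 2 ≤ k) (h : ℕ) (hh : 2 ^ k ≤ h) (η : ℝ)
    (hη : 0 < η) :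
    ∃ C : ℝ, 0 ≤ C ∧ ∀ (L q : ℕ) [NeZero q], 2 * (2 ^ k * (2 ^ L) ^ k) < q →
      ∑ a : ZMod q, ‖weightedSum k ((k : ℝ) / h - 1 - 2 * η) L q a‖ ^ h ≤ q * C := by
  have hh0 : 0 < h := lt_of_lt_of_le (by positivity) hh
  have hhr : (0 : ℝ) < h := by exact_mod_cast hh0
  obtain ⟨C, hC, hD⟩ := sum_norm_dyadicSum_pow_le k hk h hh (h * η) (by positivity)
  have hb : (2 : ℝ) ^ (-η) < 1 := Real.rpow_lt_one_of_one_lt_of_neg (by norm_num) (by linarith)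
  set S : ℝ := (1 - 2 ^ (-η))⁻¹ with hS
  have hS0 : 0 < S := inv_pos.2 (by linarith)
  have hgeo : ∀ L, ∑ u ∈ range L, (2 : ℝ) ^ (-η * u) ≤ S := by
    intro L
    simp only [Real.rpow_mul_natCast (show (0 : ℝ) ≤ 2 by norm_num)]
    have hb0 : (0 : ℝ) ≤ 2 ^ (-η) := by positivity
    rw [hS, ← tsum_geometric_of_lt_one hb0 hb]
    exact (summable_geometric_of_lt_one hb0 hb).sum_le_tsum _ fun _ _ => by positivity
  refine ⟨S ^ (h - 1) * (S * C), by positivity, fun L q _ hq => ?_⟩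
  set σ : ℝ := (k : ℝ) / h - 1 - 2 * η with hσ
  have hpt : ∀ a : ZMod q, ‖weightedSum k σ L q a‖ ^ h ≤ S ^ (h - 1) * ∑ u ∈ range L,
      (2 : ℝ) ^ (-η * u) * ((2 : ℝ) ^ ((σ + η) * u) * ‖dyadicSum k q u a‖) ^ h := by
    intro a
    refine le_trans ?_ (sum_mul_pow_le (range L) _ _ (fun _ _ => by positivity)
      (fun _ _ => by positivity) h hh0 S (hgeo L))
    refine pow_le_pow_left₀ (norm_nonneg _) ?_ _
    rw [weightedSum_eq]
    refine (norm_sum_le _ _).trans (sum_le_sum fun u _ => ?_)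
    rw [norm_mul, Complex.norm_real, Real.norm_of_nonneg (by positivity), ← mul_assoc,
      ← Real.rpow_add (by norm_num)]
    refine le_of_eq ?_
    congr 2
    ring
  calc ∑ a : ZMod q, ‖weightedSum k σ L q a‖ ^ h
      ≤ ∑ a : ZMod q, S ^ (h - 1) * ∑ u ∈ range L,
        (2 : ℝ) ^ (-η * u) * ((2 : ℝ) ^ ((σ + η) * u) * ‖dyadicSum k q u a‖) ^ h :=
        sum_le_sum fun a _ => hpt a
    _ = S ^ (h - 1) * ∑ u ∈ range L, (2 : ℝ) ^ (-η * u) *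
        (((2 : ℝ) ^ ((σ + η) * u)) ^ h * ∑ a : ZMod q, ‖dyadicSum k q u a‖ ^ h) := by
        rw [← mul_sum, sum_comm]
        simp only [mul_pow, mul_sum]
    _ ≤ S ^ (h - 1) * ∑ u ∈ range L, (2 : ℝ) ^ (-η * u) * (q * C) := by
        refine mul_le_mul_of_nonneg_left (sum_le_sum fun u hu => ?_) (by positivity)
        refine mul_le_mul_of_nonneg_left ?_ (by positivity)
        have hu' := mem_range.1 hu
        have hq' : 2 * (2 ^ k * (2 ^ (u + 1)) ^ k) < q := by
          refine lt_of_le_of_lt ?_ hq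
          gcongr
          · norm_num
          · exact hu'
        calc _ ≤ ((2 : ℝ) ^ ((σ + η) * u)) ^ h *
              (q * C * (2 : ℝ) ^ (u * (h - k + h * η))) := by
              gcongr
              exact hD u q hq'
          _ = (2 : ℝ) ^ ((σ + η) * u * h + u * (h - k + h * η)) * (q * C) := by
              rw [← Real.rpow_mul_natCast (by norm_num), Real.rpow_add (by norm_num)]
              ring
          _ = (2 : ℝ) ^ (0 : ℝ) * (q * C) := by
              congr 2
              simp only [hσ]
              field_simp
              ring
          _ = _ := by simp
    _ = S ^ (h - 1) * ((∑ u ∈ range L, (2 : ℝ) ^ (-η * u)) * (q * C)) := by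
        rw [sum_mul]
    _ ≤ S ^ (h - 1) * (S * (q * C)) := by
        gcongr
        exact hgeo L
    _ = _ := by ring

/-- The `j`-element sets of positive integers whose `k`-th powers add up to `n`. -/
def powSets (k j n : ℕ) : Finset (Finset ℕ) :=
  ((Icc 1 n).powersetCard j).filter fun S => ∑ m ∈ S, m ^ k = n

theorem addChar_map_sum {ι A M : Type*} [AddCommMonoid A] [CommMonoid M] (ψ : AddChar A M)
    (s : Finset ι) (f : ι → A) : ψ (∑ i ∈ s, f i) = ∏ i ∈ s, ψ (f i) := by
  classical
  induction s using Finset.induction_on with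
  | empty => simp
  | insert a s ha ih => rw [sum_insert ha, prod_insert ha, AddChar.map_add_eq_mul, ih]

theorem weightedSum_pow_mul (k : ℕ) (σ : ℝ) (L q : ℕ) [NeZero q] (j n : ℕ) (a : ZMod q) :
    weightedSum k σ L q a ^ j * ZMod.stdAddChar (-(a * (n : ZMod q))) =
      ∑ x ∈ Fintype.piFinset fun _ : Fin j => Ico 1 (2 ^ L),
        ((∏ i, (2 : ℝ) ^ (σ * Nat.log 2 (x i)) : ℝ) : ℂ) *
          ZMod.stdAddChar (a * (((∑ i, x i ^ k : ℕ) : ZMod q) - (n : ZMod q))) := by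
  have h1 : weightedSum k σ L q a ^ j = ∏ _i : Fin j, weightedSum k σ L q a := by simp
  rw [h1]
  simp only [weightedSum]
  rw [prod_univ_sum, sum_mul]
  refine sum_congr rfl fun x _ => ?_
  rw [prod_mul_distrib, mul_assoc]
  congr 1
  · push_cast
    rfl
  · rw [mul_sub, sub_eq_add_neg, AddChar.map_add_eq_mul]
    congr 1
    push_cast
    rw [mul_sum, addChar_map_sum]

theorem sum_tuples_le (k : ℕ) (σ : ℝ) (L q : ℕ) [NeZero q] (j n : ℕ) :
    q * ∑ x ∈ (Fintype.piFinset fun _ : Fin j => Ico 1 (2 ^ L)).filter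
      (fun x => ∑ i, x i ^ k = n), ∏ i, (2 : ℝ) ^ (σ * Nat.log 2 (x i)) ≤
      ∑ a : ZMod q, ‖weightedSum k σ L q a‖ ^ j := by
  have h1 : ∑ a : ZMod q, weightedSum k σ L q a ^ j * ZMod.stdAddChar (-(a * (n : ZMod q))) =
      ((∑ x ∈ Fintype.piFinset fun _ : Fin j => Ico 1 (2 ^ L),
        (∏ i, (2 : ℝ) ^ (σ * Nat.log 2 (x i))) *
          if (((∑ i, x i ^ k : ℕ) : ZMod q) - (n : ZMod q)) = 0 then (q : ℝ) else 0 : ℝ) : ℂ) := by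
    simp only [weightedSum_pow_mul]
    rw [sum_comm, Complex.ofReal_sum]
    refine sum_congr rfl fun x _ => ?_
    rw [← mul_sum, sum_stdAddChar_mul, Complex.ofReal_mul]
    congr 1
    split_ifs <;> simp
  have h2 : (q : ℝ) * ∑ x ∈ (Fintype.piFinset fun _ : Fin j => Ico 1 (2 ^ L)).filter
      (fun x => ∑ i, x i ^ k = n), ∏ i, (2 : ℝ) ^ (σ * Nat.log 2 (x i)) ≤
      ∑ x ∈ Fintype.piFinset fun _ : Fin j => Ico 1 (2 ^ L),
        (∏ i, (2 : ℝ) ^ (σ * Nat.log 2 (x i))) *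
          if (((∑ i, x i ^ k : ℕ) : ZMod q) - (n : ZMod q)) = 0 then (q : ℝ) else 0 := by
    rw [sum_filter, mul_sum]
    refine sum_le_sum fun x _ => ?_
    have hp : 0 ≤ ∏ i, (2 : ℝ) ^ (σ * Nat.log 2 (x i)) := prod_nonneg fun _ _ => by positivity
    by_cases hx : ∑ i, x i ^ k = n
    · rw [if_pos hx, if_pos (by rw [hx, sub_self]), mul_comm]
    · rw [if_neg hx, mul_zero]
      split_ifs <;> positivity
  refine h2.trans ?_
  refine (le_abs_self _).trans ?_
  rw [← Real.norm_eq_abs, ← Complex.norm_real, ← h1]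
  refine (norm_sum_le _ _).trans (sum_le_sum fun a _ => ?_)
  rw [norm_mul, norm_pow, AddChar.norm_apply, mul_one]

theorem sum_powSets_le_sum_tuples (k j n L : ℕ) (hL : n < 2 ^ L) (W : ℕ → ℝ) (hW : ∀ m, 0 ≤ W m) :
    ∑ S ∈ powSets k j n, ∏ m ∈ S, W m ≤
      ∑ x ∈ (Fintype.piFinset fun _ : Fin j => Ico 1 (2 ^ L)).filter
        (fun x => ∑ i, x i ^ k = n), ∏ i, W (x i) := by
  classical
  set e : Finset ℕ → Fin j → ℕ := fun S => if hS : #S = j then S.orderEmbOfFin hS else 0 with he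
  have hprod : ∀ S ∈ powSets k j n, ∏ i, W (e S i) = ∏ m ∈ S, W m := by
    intro S hS
    have hc : #S = j := (mem_powersetCard.1 (mem_filter.1 hS).1).2
    simp only [he, dif_pos hc]
    rw [← prod_coe_sort S]
    exact Fintype.prod_equiv (S.orderIsoOfFin hc).toEquiv _ _ fun i => rfl
  have hsum : ∀ S ∈ powSets k j n, ∑ i, e S i ^ k = n := by
    intro S hS
    have hc : #S = j := (mem_powersetCard.1 (mem_filter.1 hS).1).2
    refine Eq.trans ?_ (mem_filter.1 hS).2
    simp only [he, dif_pos hc]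
    rw [← sum_coe_sort S]
    exact Fintype.sum_equiv (S.orderIsoOfFin hc).toEquiv _ _ fun i => rfl
  have hinj : Set.InjOn e (powSets k j n) := by
    intro S hS T hT hST
    have hc : #S = j := (mem_powersetCard.1 (mem_filter.1 (mem_coe.1 hS)).1).2
    have hc' : #T = j := (mem_powersetCard.1 (mem_filter.1 (mem_coe.1 hT)).1).2
    simp only [he, dif_pos hc, dif_pos hc'] at hST
    rw [← coe_inj, ← range_orderEmbOfFin S hc, ← range_orderEmbOfFin T hc', hST]
  rw [← sum_congr rfl hprod, ← sum_image (f := fun x => ∏ i, W (x i)) hinj]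
  refine sum_le_sum_of_subset_of_nonneg ?_ fun x _ _ => prod_nonneg fun i _ => hW _
  intro x hx
  obtain ⟨S, hS, rfl⟩ := mem_image.1 hx
  rw [mem_filter, Fintype.mem_piFinset]
  refine ⟨fun i => ?_, hsum S hS⟩
  obtain ⟨hsub, hc⟩ := mem_powersetCard.1 (mem_filter.1 hS).1
  have : e S i ∈ S := by
    simp only [he, dif_pos hc]
    exact orderEmbOfFin_mem S hc i
  have := mem_Icc.1 (hsub this)
  exact mem_Ico.2 ⟨this.1, by omega⟩

theorem le_of_sum_pow_eq (k j n h : ℕ) (hk : 1 ≤ k) (hjh : j ≤ h) (η : ℝ) (hη : 0 < η)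
    (x : Fin j → ℕ) (hx : ∑ i, x i ^ k = n) :
    (n : ℝ) ^ (η / k) ≤ (h * 2 ^ k : ℝ) ^ (η / k) * ∏ i, (2 : ℝ) ^ (η * Nat.log 2 (x i)) := by
  have hk0 : (0 : ℝ) < k := by exact_mod_cast hk
  have h1 : n ≤ h * 2 ^ k * (2 ^ k) ^ ∑ i, Nat.log 2 (x i) := by
    rw [← hx]
    calc ∑ i, x i ^ k ≤ ∑ _i : Fin j, 2 ^ k * (2 ^ k) ^ ∑ i, Nat.log 2 (x i) := by
          refine sum_le_sum fun i _ => ?_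
          calc x i ^ k ≤ (2 ^ (Nat.log 2 (x i) + 1)) ^ k :=
                Nat.pow_le_pow_left (Nat.lt_pow_succ_log_self (by norm_num) _).le k
            _ = 2 ^ k * (2 ^ k) ^ Nat.log 2 (x i) := by
                rw [← pow_mul, ← pow_mul, ← pow_add]
                congr 1
                ring
            _ ≤ _ := by
                gcongr
                · exact Nat.one_le_two_pow
                · exact single_le_sum (f := fun i => Nat.log 2 (x i)) (fun _ _ => Nat.zero_le _)
                    (mem_univ i)
      _ = j * (2 ^ k * (2 ^ k) ^ ∑ i, Nat.log 2 (x i)) := by simp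
      _ ≤ _ := by
          rw [mul_assoc]
          gcongr
  have h2 : (n : ℝ) ≤ h * 2 ^ k * (2 ^ k) ^ ∑ i, Nat.log 2 (x i) := by exact_mod_cast h1
  calc (n : ℝ) ^ (η / k) ≤ (h * 2 ^ k * (2 ^ k) ^ ∑ i, Nat.log 2 (x i) : ℝ) ^ (η / k) := by
        gcongr
    _ = _ := by
        rw [Real.mul_rpow (by positivity) (by positivity)]
        congr 1
        rw [← Real.rpow_sum_of_pos (by norm_num), ← mul_sum, ← pow_mul, ← Real.rpow_natCast,
          ← Real.rpow_mul (by norm_num)]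
        congr 1
        push_cast
        field_simp

theorem sum_powSets_le (k : ℕ) (hk : 2 ≤ k) (h : ℕ) (hh : 2 ^ k ≤ h) (η : ℝ) (hη : 0 < η) :
    ∃ C : ℝ, 0 < C ∧ ∀ W : ℕ → ℝ, (∀ m, 0 ≤ W m) →
      (∀ m, 1 ≤ m → W m ≤ (2 : ℝ) ^ (((k : ℝ) / h - 1 - 3 * η) * Nat.log 2 m)) →
      ∀ j, j ≤ h → ∀ n : ℕ, 1 ≤ n →
        ∑ S ∈ powSets k j n, ∏ m ∈ S, W m ≤ C * (n : ℝ) ^ (-(η / k)) := by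
  obtain ⟨C, hC, hF⟩ := sum_norm_weightedSum_pow_le k hk h hh η hη
  have hh0 : 0 < h := lt_of_lt_of_le (by positivity) hh
  refine ⟨(h * 2 ^ k : ℝ) ^ (η / k) * (1 + C), by positivity, fun W hW0 hW j hj n hn => ?_⟩
  set σ : ℝ := (k : ℝ) / h - 1 - 2 * η with hσ
  have hn0 : (0 : ℝ) < n := by exact_mod_cast hn
  set q := 2 * (2 ^ k * (2 ^ n) ^ k) + 1 with hq
  have hq0 : (0 : ℝ) < q := by positivity
  have hT : ∑ x ∈ (Fintype.piFinset fun _ : Fin j => Ico 1 (2 ^ n)).filter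
      (fun x => ∑ i, x i ^ k = n), ∏ i, (2 : ℝ) ^ (σ * Nat.log 2 (x i)) ≤ 1 + C := by
    have h1 := sum_tuples_le k σ n q j n
    have h2 : ∑ a : ZMod q, ‖weightedSum k σ n q a‖ ^ j ≤ q * (1 + C) := by
      calc ∑ a : ZMod q, ‖weightedSum k σ n q a‖ ^ j
          ≤ ∑ a : ZMod q, (1 + ‖weightedSum k σ n q a‖ ^ h) := by
            refine sum_le_sum fun a _ => ?_
            rcases le_total ‖weightedSum k σ n q a‖ 1 with h3 | h3
            · have := pow_le_one₀ (n := j) (norm_nonneg _) h3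
              have h4 : 0 ≤ ‖weightedSum k σ n q a‖ ^ h := by positivity
              linarith
            · have := pow_le_pow_right₀ h3 hj
              linarith
        _ = q + ∑ a : ZMod q, ‖weightedSum k σ n q a‖ ^ h := by
            rw [sum_add_distrib]
            simp [ZMod.card]
        _ ≤ q + q * C := by
            gcongr
            exact hF n q (by omega)
        _ = _ := by ring
    exact le_of_mul_le_mul_left (h1.trans h2) hq0
  refine (sum_powSets_le_sum_tuples k j n n Nat.lt_two_pow_self W hW0).trans ?_
  rw [Real.rpow_neg hn0.le, ← div_eq_mul_inv, le_div_iff₀ (by positivity), sum_mul]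
  refine le_trans (sum_le_sum fun x hx => ?_) (le_trans (mul_sum _ _ _).symm.le
    (mul_le_mul_of_nonneg_left hT (by positivity)))
  obtain ⟨hx1, hx2⟩ := mem_filter.1 hx
  rw [Fintype.mem_piFinset] at hx1
  calc (∏ i, W (x i)) * (n : ℝ) ^ (η / k)
      ≤ (∏ i, (2 : ℝ) ^ ((σ - η) * Nat.log 2 (x i))) *
        ((h * 2 ^ k : ℝ) ^ (η / k) * ∏ i, (2 : ℝ) ^ (η * Nat.log 2 (x i))) := by
        refine mul_le_mul (prod_le_prod (fun i _ => hW0 _) fun i _ => ?_)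
          (le_of_sum_pow_eq k j n h (by omega) hj η hη x hx2) (by positivity)
          (prod_nonneg fun _ _ => by positivity)
        refine (hW _ (mem_Ico.1 (hx1 i)).1).trans (le_of_eq ?_)
        congr 2
        rw [hσ]
        ring
    _ = (h * 2 ^ k : ℝ) ^ (η / k) * ∏ i, ((2 : ℝ) ^ ((σ - η) * Nat.log 2 (x i)) *
        (2 : ℝ) ^ (η * Nat.log 2 (x i))) := by
        rw [prod_mul_distrib]
        ring
    _ = _ := by
        congr 1
        refine prod_congr rfl fun i _ => ?_
        rw [← Real.rpow_add (by norm_num)]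
        congr 1
        ring

theorem sum_powersetCard_prod_le {α : Type*} [DecidableEq α] (s : Finset α) (f : α → ℝ)
    (hf : ∀ a, 0 ≤ f a) (T : ℕ) :
    ∑ F ∈ s.powersetCard T, ∏ a ∈ F, f a ≤ (∑ a ∈ s, f a) ^ T := by
  induction s using Finset.induction_on generalizing T with
  | empty =>
    cases T with
    | zero => simp
    | succ T => rw [powersetCard_eq_empty.2 (by simp)]; simp
  | insert a s ha ih =>
    cases T with
    | zero => simp
    | succ T =>
      have hs : 0 ≤ ∑ b ∈ s, f b := sum_nonneg fun _ _ => hf _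
      have hdisj : Disjoint (powersetCard (T + 1) s) ((powersetCard T s).image (insert a)) := by
        rw [disjoint_left]
        intro F hF hF'
        obtain ⟨G, _, rfl⟩ := mem_image.1 hF'
        exact ha ((mem_powersetCard.1 hF).1 (mem_insert_self a G))
      have hnot : ∀ G ∈ powersetCard T s, a ∉ G := fun G hG h => ha ((mem_powersetCard.1 hG).1 h)
      have hinj : Set.InjOn (insert a) (powersetCard T s : Set (Finset α)) := by
        intro G hG G' hG' h
        rw [← erase_insert (hnot G hG), ← erase_insert (hnot G' hG'), h]
      rw [powersetCard_succ_insert ha, sum_union hdisj, sum_image hinj, sum_insert ha]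
      have h1 : ∑ G ∈ powersetCard T s, ∏ b ∈ insert a G, f b =
          f a * ∑ G ∈ powersetCard T s, ∏ b ∈ G, f b := by
        rw [mul_sum]
        exact sum_congr rfl fun G hG => prod_insert (hnot G hG)
      rw [h1]
      calc _ ≤ (∑ b ∈ s, f b) ^ (T + 1) + f a * (∑ b ∈ s, f b) ^ T := by
            gcongr
            · exact ih _
            · exact hf a
            · exact ih _
        _ = (f a + ∑ b ∈ s, f b) * (∑ b ∈ s, f b) ^ T := by ring
        _ ≤ (f a + ∑ b ∈ s, f b) * (f a + ∑ b ∈ s, f b) ^ T := by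
            have := hf a
            gcongr
            linarith
        _ = _ := by ring

/-- If `B` contains no more than `T` pairwise disjoint sets from any family `powSets k j n` with
`1 ≤ j ≤ h`, then each of these families has boundedly many members inside `B`. -/
theorem card_filter_powSets_le (k h T : ℕ) (hk : k ≠ 0) (B : Set ℕ) [DecidablePred fun S : Finset ℕ => ↑S ⊆ B]
    (hT : ∀ j n, 1 ≤ j → j ≤ h → ∀ F ⊆ powSets k j n, (∀ S ∈ F, (S : Set ℕ) ⊆ B) →
      (F : Set (Finset ℕ)).PairwiseDisjoint id → #F ≤ T) (j : ℕ) (hj : j ≤ h) :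
    ∀ n, #((powSets k j n).filter fun S => ↑S ⊆ B) ≤ (T * h) ^ j := by
  classical
  induction j with
  | zero =>
    intro n
    rw [pow_zero]
    refine (card_le_card (filter_subset _ _)).trans ?_
    refine (card_le_card (filter_subset _ _)).trans ?_
    simp
  | succ j ih =>
    intro n
    set P := (powSets k (j + 1) n).filter fun S => ↑S ⊆ B with hP
    obtain ⟨F, hF, hmax⟩ := exists_max_image
      (P.powerset.filter fun F : Finset (Finset ℕ) => (F : Set (Finset ℕ)).PairwiseDisjoint id) card
      ⟨∅, by simp⟩
    rw [mem_filter, mem_powerset] at hF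
    obtain ⟨hFP, hFd⟩ := hF
    have hFT : #F ≤ T := hT (j + 1) n (by omega) hj F (hFP.trans (filter_subset _ _))
      (fun S hS => (mem_filter.1 (hFP hS)).2) hFd
    set U := F.biUnion id with hU
    have hcard : ∀ S ∈ P, #S = j + 1 := fun S hS =>
      (mem_powersetCard.1 (mem_filter.1 (mem_filter.1 hS).1).1).2
    have hUc : #U ≤ T * h := by
      refine (card_biUnion_le_card_mul F id (j + 1) fun S hS => (hcard S (hFP hS)).le).trans ?_
      gcongr
    have hmeet : ∀ S ∈ P, ∃ u ∈ U, u ∈ S := by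
      intro S hS
      by_contra! hcon
      have hSF : S ∉ F := by
        intro hSF
        obtain ⟨u, hu⟩ : S.Nonempty := card_pos.1 (by rw [hcard S hS]; omega)
        exact hcon u (mem_biUnion.2 ⟨S, hSF, hu⟩) hu
      have h1 := hmax (insert S F) (by
        rw [mem_filter, mem_powerset]
        refine ⟨insert_subset hS hFP, ?_⟩
        rw [coe_insert]
        refine hFd.insert fun G hG _ => ?_
        rw [id, id, disjoint_left]
        intro u hu hu'
        exact hcon u (mem_biUnion.2 ⟨G, hG, hu'⟩) hu)
      rw [card_insert_of_notMem hSF] at h1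
      omega
    have hsub : P ⊆ U.biUnion fun u =>
        (((powSets k j (n - u ^ k)).filter fun S => ↑S ⊆ B)).image (insert u) := by
      intro S hS
      obtain ⟨u, hu, huS⟩ := hmeet S hS
      obtain ⟨hS1, hSB⟩ := mem_filter.1 hS
      obtain ⟨hS2, hsum⟩ := mem_filter.1 hS1
      obtain ⟨hS3, hSc⟩ := mem_powersetCard.1 hS2
      rw [mem_biUnion]
      refine ⟨u, hu, mem_image.2 ⟨S.erase u, ?_, insert_erase huS⟩⟩
      have hs := add_sum_erase S (fun m => m ^ k) huS
      have hs' : ∑ m ∈ S.erase u, m ^ k = n - u ^ k := by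
        omega
      rw [mem_filter, powSets, mem_filter, mem_powersetCard]
      refine ⟨⟨⟨fun m hm => ?_, by rw [card_erase_of_mem huS, hSc]; rfl⟩, hs'⟩, ?_⟩
      · have h1 := mem_Icc.1 (hS3 (mem_of_mem_erase hm))
        rw [mem_Icc]
        refine ⟨h1.1, ?_⟩
        rw [← hs']
        exact (Nat.le_self_pow hk m).trans
          (single_le_sum (f := fun m => m ^ k) (fun _ _ => Nat.zero_le _) hm)
      · exact (coe_subset.2 (erase_subset _ _)).trans hSB
    calc #P ≤ _ := card_le_card hsub
      _ ≤ #U * (T * h) ^ j := card_biUnion_le_card_mul _ _ _ fun u _ =>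
          card_image_le.trans (ih (by omega) _)
      _ ≤ (T * h) * (T * h) ^ j := by gcongr
      _ = _ := by ring

theorem card_le_of_pairwiseDisjoint_powSets (k j n : ℕ) (hj : 1 ≤ j) (F : Finset (Finset ℕ))
    (hF : F ⊆ powSets k j n) (hd : (F : Set (Finset ℕ)).PairwiseDisjoint id) : #F ≤ n := by
  have h1 : ∀ S ∈ F, S.Nonempty ∧ S ⊆ Icc 1 n := by
    intro S hS
    obtain ⟨h2, h3⟩ := mem_powersetCard.1 (mem_filter.1 (hF hS)).1
    exact ⟨card_pos.1 (by omega), h2⟩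
  calc #F ≤ #(F.biUnion id) := card_le_card_biUnion hd fun S hS => (h1 S hS).1
    _ ≤ #(Icc 1 n) := card_le_card (biUnion_subset.2 fun S hS => (h1 S hS).2)
    _ = n := by simp

open MeasureTheory in
theorem exists_selection {ι κ : Type*} (N : ι → ℕ) (hN : ∀ i, 0 < N i) (idx : ℕ → ι) (off : ℕ → ℕ)
    (hinj : ∀ m m', idx m = idx m' → off m = off m' → m = m')
    (I : ℕ → Finset κ) (F : κ → Finset ℕ) (b : ℕ → ℝ) (hb : Summable b) (hb1 : ∑' n, b n < 1)
    (hI : ∀ n, ∑ a ∈ I n, ∏ m ∈ F a, ((N (idx m) : ℝ))⁻¹ ≤ b n) :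
    ∃ ω : ∀ i, Fin (N i), ∀ n, ∀ a ∈ I n, ∃ m ∈ F a, (ω (idx m)).val ≠ off m := by
  classical
  have : ∀ i, Nonempty (Fin (N i)) := fun i => ⟨⟨0, hN i⟩⟩
  let _ : ∀ i, MeasurableSpace (Fin (N i)) := fun i => ⊤
  set μ : ∀ i, Measure (Fin (N i)) := fun i => (PMF.uniformOfFintype (Fin (N i))).toMeasure with hμ
  have : ∀ i, IsProbabilityMeasure (μ i) := fun i => PMF.toMeasure.isProbabilityMeasure _
  set P := Measure.infinitePi μ with hP
  have hpt : ∀ i t, μ i {x | x.val = t} ≤ ENNReal.ofReal ((N i : ℝ)⁻¹) := by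
    intro i t
    have hsub : ∃ y : Fin (N i), {x : Fin (N i) | x.val = t} ⊆ {y} := by
      by_cases ht : t < N i
      · exact ⟨⟨t, ht⟩, fun x hx => Fin.ext hx⟩
      · exact ⟨⟨0, hN i⟩, fun x hx => absurd (hx ▸ x.2) ht⟩
    obtain ⟨y, hy⟩ := hsub
    refine (measure_mono hy).trans ?_
    rw [hμ, PMF.toMeasure_apply_singleton _ _ (MeasurableSet.singleton _),
      PMF.uniformOfFintype_apply, Fintype.card_fin, ENNReal.ofReal_inv_of_pos
      (by exact_mod_cast hN i), ENNReal.ofReal_natCast]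
  have hE : ∀ a, P {ω | ∀ m ∈ F a, (ω (idx m)).val = off m} ≤
      ENNReal.ofReal (∏ m ∈ F a, ((N (idx m) : ℝ))⁻¹) := by
    intro a
    by_cases hi : Set.InjOn idx (F a)
    · have hsub : {ω : ∀ i, Fin (N i) | ∀ m ∈ F a, (ω (idx m)).val = off m} ⊆
          Set.pi ((F a).image idx : Finset ι)
            (fun i => {x : Fin (N i) | ∀ m ∈ F a, idx m = i → x.val = off m}) := by
        rintro ω hω i _ m hm rfl
        exact hω m hm
      refine (measure_mono hsub).trans ?_
      rw [hP, Measure.infinitePi_pi _ fun i _ => MeasurableSpace.measurableSet_top, prod_image hi,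
        ENNReal.ofReal_prod_of_nonneg fun _ _ => by positivity]
      refine prod_le_prod' fun m hm => ?_
      have hle : {x : Fin (N (idx m)) | ∀ m' ∈ F a, idx m' = idx m → x.val = off m'} ⊆
          {x | x.val = off m} := fun x hx => hx m hm rfl
      exact (measure_mono hle).trans (hpt _ (off m))
    · have : {ω : ∀ i, Fin (N i) | ∀ m ∈ F a, (ω (idx m)).val = off m} = ∅ := by
        rw [Set.eq_empty_iff_forall_notMem]
        intro ω hω
        refine hi fun m hm m' hm' h => hinj m m' h ?_
        rw [← hω m hm, ← hω m' hm', h]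
      rw [this, measure_empty]
      exact zero_le
  have hb0 : ∀ n, 0 ≤ b n := fun n =>
    (sum_nonneg fun a _ => prod_nonneg fun m _ => by positivity).trans (hI n)
  have htot : P (⋃ n, ⋃ a ∈ I n, {ω | ∀ m ∈ F a, (ω (idx m)).val = off m}) < 1 := by
    calc _ ≤ ∑' n, P (⋃ a ∈ I n, {ω | ∀ m ∈ F a, (ω (idx m)).val = off m}) :=
          measure_iUnion_le _
      _ ≤ ∑' n, ENNReal.ofReal (b n) := by
          refine ENNReal.tsum_le_tsum fun n => ?_
          refine (measure_biUnion_finset_le _ _).trans ((sum_le_sum fun a _ => hE a).trans ?_)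
          rw [← ENNReal.ofReal_sum_of_nonneg fun a _ => prod_nonneg fun m _ => by positivity]
          exact ENNReal.ofReal_le_ofReal (hI n)
      _ = ENNReal.ofReal (∑' n, b n) := (ENNReal.ofReal_tsum_of_nonneg hb0 hb).symm
      _ < 1 := by rwa [ENNReal.ofReal_lt_one]
  by_contra! hcon
  have huniv : (⋃ n, ⋃ a ∈ I n, {ω : ∀ i, Fin (N i) | ∀ m ∈ F a, (ω (idx m)).val = off m}) =
      Set.univ := by
    rw [Set.eq_univ_iff_forall]
    intro ω
    obtain ⟨n, a, ha, h⟩ := hcon ω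
    simp only [Set.mem_iUnion]
    exact ⟨n, a, ha, h⟩
  rw [huniv, measure_univ] at htot
  exact lt_irrefl _ htot

theorem exists_sparse_set (k : ℕ) (hk : 2 ≤ k) (h : ℕ) (hh : 2 ^ k ≤ h) (η : ℝ) (hη : 0 < η)
    (v : ℕ → ℕ) (hv : ∀ u, v u ≤ u) (hvu : ∀ u, (v u : ℝ) ≤ ((k : ℝ) / h - 3 * η) * u) :
    ∃ B : Set ℕ, (∀ u, ∃ G ⊆ Ico (2 ^ u) (2 ^ (u + 1)), #G = 2 ^ v u ∧ ↑G ⊆ B) ∧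
      ∃ T, ∀ j n, 1 ≤ j → j ≤ h → ∀ F ⊆ powSets k j n, (∀ S ∈ F, (S : Set ℕ) ⊆ B) →
        (F : Set (Finset ℕ)).PairwiseDisjoint id → #F ≤ T := by
  classical
  obtain ⟨C, hC, hsum⟩ := sum_powSets_le k hk h hh η hη
  have hk0 : (0 : ℝ) < k := by exact_mod_cast (by omega : 0 < k)
  obtain ⟨T, hT⟩ := exists_nat_ge (2 * k / η)
  have hT2 : 2 ≤ T * (η / k) := by
    rw [div_le_iff₀ hη] at hT
    rw [← mul_div_assoc, le_div_iff₀ hk0]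
    exact hT
  set f : ℕ → ℝ := fun n => h * C ^ T * ((n : ℝ) ^ 2)⁻¹ with hf
  have hfs : Summable f := (Real.summable_nat_pow_inv.2 (by norm_num)).mul_left _
  obtain ⟨n₀, hn₀1, hn₀⟩ : ∃ n₀, 1 ≤ n₀ ∧ ∑' n, f (n + n₀) < 1 := by
    have h1 := (tendsto_sum_nat_add f).eventually (gt_mem_nhds (zero_lt_one))
    obtain ⟨n₀, h2, h3⟩ := (h1.and (Filter.eventually_ge_atTop 1)).exists
    exact ⟨n₀, h3, h2⟩
  set s : ℕ → ℕ := fun u => 2 ^ (u - v u) with hs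
  have hs0 : ∀ u, 0 < s u := fun u => by positivity
  set idx : ℕ → ℕ × ℕ := fun m => (Nat.log 2 m, m / s (Nat.log 2 m)) with hidx
  set off : ℕ → ℕ := fun m => m % s (Nat.log 2 m) with hoff
  set N : ℕ × ℕ → ℕ := fun i => s i.1 with hN
  set W : ℕ → ℝ := fun m => ((N (idx m) : ℝ))⁻¹ with hW
  have hW0 : ∀ m, 0 ≤ W m := fun m => by positivity
  have hWle : ∀ m, 1 ≤ m → W m ≤ (2 : ℝ) ^ (((k : ℝ) / h - 1 - 3 * η) * Nat.log 2 m) := by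
    intro m _
    set u := Nat.log 2 m
    have h1 : W m = (2 : ℝ) ^ ((v u : ℝ) - u) := by
      rw [← neg_sub, Real.rpow_neg (by norm_num), ← Nat.cast_sub (hv u), Real.rpow_natCast]
      simp [hW, hN, hidx, hs, u]
    rw [h1]
    refine Real.rpow_le_rpow_of_exponent_le (by norm_num) ?_
    have := hvu u
    linarith
  set I : ℕ → Finset (Σ _ : ℕ, Finset (Finset ℕ)) := fun n => (Icc 1 h).sigma fun j =>
    ((powSets k j (n + n₀)).powersetCard T).filter fun F =>
      (F : Set (Finset ℕ)).PairwiseDisjoint id with hI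
  have hIle : ∀ n, ∑ a ∈ I n, ∏ m ∈ a.2.biUnion id, W m ≤ f (n + n₀) := by
    intro n
    rw [hI, sum_sigma]
    have hn : (0 : ℝ) < ((n + n₀ : ℕ) : ℝ) := by exact_mod_cast (by omega : 0 < n + n₀)
    have hn1 : (1 : ℝ) ≤ ((n + n₀ : ℕ) : ℝ) := by exact_mod_cast (by omega : 1 ≤ n + n₀)
    calc _ ≤ ∑ j ∈ Icc 1 h, C ^ T * (((n + n₀ : ℕ) : ℝ) ^ 2)⁻¹ := by
          refine sum_le_sum fun j hj => ?_
          calc _ = ∑ F ∈ ((powSets k j (n + n₀)).powersetCard T).filter fun F : Finset (Finset ℕ) =>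
                  (F : Set (Finset ℕ)).PairwiseDisjoint id, ∏ S ∈ F, ∏ m ∈ S, W m :=
                sum_congr rfl fun F hF => prod_biUnion (mem_filter.1 hF).2
            _ ≤ ∑ F ∈ (powSets k j (n + n₀)).powersetCard T, ∏ S ∈ F, ∏ m ∈ S, W m :=
                sum_le_sum_of_subset_of_nonneg (filter_subset _ _) fun F _ _ =>
                  prod_nonneg fun S _ => prod_nonneg fun m _ => hW0 m
            _ ≤ (∑ S ∈ powSets k j (n + n₀), ∏ m ∈ S, W m) ^ T :=
                sum_powersetCard_prod_le _ _ (fun S => prod_nonneg fun m _ => hW0 m) T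
            _ ≤ (C * ((n + n₀ : ℕ) : ℝ) ^ (-(η / k))) ^ T := by
                refine pow_le_pow_left₀ (sum_nonneg fun S _ => prod_nonneg fun m _ => hW0 m) ?_ T
                exact hsum W hW0 hWle j (mem_Icc.1 hj).2 _ (by omega)
            _ ≤ C ^ T * (((n + n₀ : ℕ) : ℝ) ^ 2)⁻¹ := by
                rw [mul_pow]
                refine mul_le_mul_of_nonneg_left ?_ (by positivity)
                rw [← Real.rpow_natCast, ← Real.rpow_natCast, ← Real.rpow_neg hn.le,
                  ← Real.rpow_mul hn.le]
                refine Real.rpow_le_rpow_of_exponent_le hn1 ?_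
                push_cast
                linarith
      _ = f (n + n₀) := by
          rw [hf, sum_const, Nat.card_Icc, nsmul_eq_mul, Nat.add_sub_cancel, ← mul_assoc]
  have hinj : ∀ m m', idx m = idx m' → off m = off m' → m = m' := by
    intro m m' h1 h2
    obtain ⟨h3, h4⟩ := Prod.ext_iff.1 h1
    simp only [hidx, hoff] at h2 h3 h4
    rw [h3] at h2 h4
    have h5 := Nat.div_add_mod m (s (Nat.log 2 m'))
    rwa [h2, h4, Nat.div_add_mod, eq_comm] at h5
  obtain ⟨ω, hω⟩ := exists_selection N (fun i => hs0 i.1) idx off hinj I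
    (fun a => a.2.biUnion id) (fun n => f (n + n₀)) ((summable_nat_add_iff n₀).2 hfs) hn₀ hIle
  refine ⟨{m | (ω (idx m)).val = off m}, fun u => ?_, max T n₀, ?_⟩
  · set g : ℕ → ℕ := fun i => s u * i + (ω (u, i)).val with hg
    have hlt : ∀ i, (ω (u, i)).val < s u := fun i => (ω (u, i)).2
    have hdiv : ∀ i, g i / s u = i := fun i => by
      rw [hg, Nat.mul_add_div (hs0 u), Nat.div_eq_of_lt (hlt i), add_zero]
    have hpow : s u * 2 ^ v u = 2 ^ u := by
      rw [hs, ← pow_add, Nat.sub_add_cancel (hv u)]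
    have hmem : ∀ i ∈ Ico (2 ^ v u) (2 ^ (v u + 1)), g i ∈ Ico (2 ^ u) (2 ^ (u + 1)) := by
      intro i hi
      obtain ⟨h1, h2⟩ := mem_Ico.1 hi
      rw [mem_Ico]
      constructor
      · rw [← hpow]
        exact (Nat.mul_le_mul_left _ h1).trans (Nat.le_add_right _ _)
      · calc g i < s u * (i + 1) := by
              rw [mul_add, mul_one]
              exact Nat.add_lt_add_left (hlt i) _
          _ ≤ s u * 2 ^ (v u + 1) := Nat.mul_le_mul_left _ h2
          _ = _ := by rw [pow_succ, ← mul_assoc, hpow, pow_succ]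
    refine ⟨(Ico (2 ^ v u) (2 ^ (v u + 1))).image g, image_subset_iff.2 hmem, ?_, ?_⟩
    · rw [card_image_of_injective _ fun i i' hii => by rw [← hdiv i, ← hdiv i', hii], Nat.card_Ico,
        pow_succ, mul_two, Nat.add_sub_cancel]
    · intro m hm
      obtain ⟨i, hi, rfl⟩ := mem_image.1 (mem_coe.1 hm)
      obtain ⟨h1, h2⟩ := mem_Ico.1 (hmem i hi)
      have hlog : Nat.log 2 (g i) = u := Nat.log_eq_of_pow_le_of_lt_pow h1 h2
      have h3 : idx (g i) = (u, i) := by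
        simp only [hidx, hlog, hdiv]
      have h4 : off (g i) = (ω (u, i)).val := by
        simp only [hoff, hlog]
        rw [hg, Nat.mul_add_mod, Nat.mod_eq_of_lt (hlt i)]
      rw [Set.mem_ofPred_eq, h3, h4]
  · intro j n hj hjh F hF hFB hd
    by_cases hn : n < n₀
    · exact (card_le_of_pairwiseDisjoint_powSets k j n hj F hF hd).trans
        (hn.le.trans (le_max_right _ _))
    · refine le_trans ?_ (le_max_left _ _)
      by_contra! hcard
      obtain ⟨F', hF', hc⟩ := exists_subset_card_eq hcard.le
      obtain ⟨n', rfl⟩ := Nat.exists_eq_add_of_le' (not_lt.1 hn)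
      obtain ⟨m, hm, hne⟩ := hω n' ⟨j, F'⟩ (mem_sigma.2 ⟨mem_Icc.2 ⟨hj, hjh⟩, mem_filter.2
        ⟨mem_powersetCard.2 ⟨hF'.trans hF, hc⟩, hd.subset (coe_subset.2 hF')⟩⟩)
      obtain ⟨S, hS, hmS⟩ := mem_biUnion.1 hm
      exact hne (hFB S (hF' hS) hmS)

end

open Finset in
theorem Rcnt_le_card_filter_powSets (k : ℕ) (hk : k ≠ 0) (B : Set ℕ)
    [DecidablePred fun S : Finset ℕ => ↑S ⊆ B] (h n : ℕ) :
    Rcnt {a | ∃ m ∈ B, 1 ≤ m ∧ a = m ^ k} h n ≤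
      #((powSets k h n).filter fun S => ↑S ⊆ B) := by
  classical
  set Φ : Finset ℕ → Fin h → ℕ := fun S =>
    if hS : #S = h then fun i => S.orderEmbOfFin hS i ^ k else 0 with hΦ
  set P := (powSets k h n).filter fun S => ↑S ⊆ B with hP
  have hsub : {f : Fin h → ℕ | StrictMono f ∧ (∀ i, f i ∈ {a | ∃ m ∈ B, 1 ≤ m ∧ a = m ^ k}) ∧
      ∑ i, f i = n} ⊆ (P.image Φ : Finset (Fin h → ℕ)) := by
    rintro f ⟨hf, hfA, hfn⟩
    choose g hgB hg1 hg using hfA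
    have hgm : StrictMono g := fun i j hij =>
      lt_of_pow_lt_pow_left₀ k (Nat.zero_le _) (by rw [← hg, ← hg]; exact hf hij)
    have hc : #(univ.image g) = h := by
      rw [card_image_of_injective _ hgm.injective, card_univ, Fintype.card_fin]
    have hsum : ∑ m ∈ univ.image g, m ^ k = n := by
      rw [sum_image hgm.injective.injOn, ← hfn]
      exact sum_congr rfl fun i _ => (hg i).symm
    rw [mem_coe, mem_image]
    refine ⟨univ.image g, ?_, ?_⟩
    · rw [hP, mem_filter, powSets, mem_filter, mem_powersetCard]
      refine ⟨⟨⟨fun m hm => ?_, hc⟩, hsum⟩, ?_⟩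
      · rw [mem_Icc]
        refine ⟨?_, ?_⟩
        · obtain ⟨i, -, rfl⟩ := mem_image.1 hm
          exact hg1 i
        · rw [← hsum]
          exact (Nat.le_self_pow hk m).trans
            (single_le_sum (f := fun m => m ^ k) (fun _ _ => Nat.zero_le _) hm)
      · intro m hm
        obtain ⟨i, -, rfl⟩ := mem_image.1 (mem_coe.1 hm)
        exact hgB i
    · rw [hΦ]
      simp only [dif_pos hc]
      have := orderEmbOfFin_unique hc (fun i => mem_image_of_mem g (mem_univ i)) hgm
      funext i
      rw [hg, ← this]
  calc Rcnt _ h n ≤ (P.image Φ : Set (Fin h → ℕ)).ncard := by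
        exact Set.ncard_le_ncard hsub (finite_toSet _)
    _ = #(P.image Φ) := Set.ncard_coe_finset _
    _ ≤ _ := card_image_le

open Finset in
theorem le_countBelow_powers (k : ℕ) (hk : k ≠ 0) (γ : ℝ) (hγ0 : 0 < γ) (hγ1 : γ ≤ 1) (B : Set ℕ)
    (hB : ∀ u : ℕ, ∃ G ⊆ Ico (2 ^ u) (2 ^ (u + 1)), #G = 2 ^ ⌊γ * (u : ℝ)⌋₊ ∧ ↑G ⊆ B) (x : ℝ)
    (hx : 2 ^ k ≤ x) :
    1 / 8 * x ^ (γ / k) ≤ countBelow {a | ∃ m ∈ B, 1 ≤ m ∧ a = m ^ k} x := by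
  have hx0 : 0 < x := lt_of_lt_of_le (by positivity) hx
  have hk0 : (0 : ℝ) < k := by exact_mod_cast Nat.pos_of_ne_zero hk
  have hfl : 2 ^ k ≤ ⌊x⌋₊ := Nat.le_floor (by exact_mod_cast hx)
  have hb : 1 < 2 ^ k := Nat.one_lt_two_pow hk
  obtain ⟨u, hu⟩ : ∃ u, Nat.log (2 ^ k) ⌊x⌋₊ = u + 1 :=
    Nat.exists_eq_add_of_le' (Nat.log_pos hb hfl)
  have hlow : ((2 ^ k) ^ (u + 1) : ℝ) ≤ x := by
    have h1 := Nat.pow_log_le_self (2 ^ k) (x := ⌊x⌋₊) (by omega)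
    rw [hu] at h1
    exact le_trans (by exact_mod_cast h1) (Nat.floor_le hx0.le)
  have hup : x ≤ (2 ^ k) ^ (u + 2) := by
    have h1 := Nat.lt_pow_succ_log_self hb ⌊x⌋₊
    rw [hu] at h1
    have h2 := (Nat.floor_lt hx0.le).1 h1
    push_cast at h2
    exact h2.le
  obtain ⟨G, hG, hGc, hGB⟩ := hB u
  have hinj : Function.Injective fun m : ℕ => m ^ k := Nat.pow_left_injective hk
  have hsub : ((G.image fun m => m ^ k : Finset ℕ) : Set ℕ) ⊆
      {a ∈ {a | ∃ m ∈ B, 1 ≤ m ∧ a = m ^ k} | (a : ℝ) ≤ x} := by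
    intro a ha
    obtain ⟨m, hm, rfl⟩ := mem_image.1 (mem_coe.1 ha)
    obtain ⟨h1, h2⟩ := mem_Ico.1 (hG hm)
    refine ⟨⟨m, hGB hm, Nat.one_le_two_pow.trans h1, rfl⟩, le_trans ?_ hlow⟩
    rw [← pow_mul, mul_comm, pow_mul]
    push_cast
    gcongr
    exact_mod_cast h2.le
  have hfin : {a ∈ {a | ∃ m ∈ B, 1 ≤ m ∧ a = m ^ k} | (a : ℝ) ≤ x}.Finite :=
    (Set.finite_Iic ⌊x⌋₊).subset fun a ha => Nat.le_floor ha.2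
  have hcount : 2 ^ ⌊γ * (u : ℝ)⌋₊ ≤ countBelow {a | ∃ m ∈ B, 1 ≤ m ∧ a = m ^ k} x := by
    rw [← hGc, ← card_image_of_injective G hinj, ← Set.ncard_coe_finset]
    exact Set.ncard_le_ncard hsub hfin
  have hcount' : (2 : ℝ) ^ ((⌊γ * (u : ℝ)⌋₊ : ℕ) : ℝ) ≤
      countBelow {a | ∃ m ∈ B, 1 ≤ m ∧ a = m ^ k} x := by
    rw [Real.rpow_natCast]
    exact_mod_cast hcount
  refine le_trans ?_ hcount'
  have hfloor := Nat.lt_floor_add_one (γ * (u : ℝ))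
  calc 1 / 8 * x ^ (γ / k) ≤ 1 / 8 * (((2 : ℝ) ^ k) ^ (u + 2)) ^ (γ / k) := by gcongr
    _ = 2 ^ (-3 : ℝ) * 2 ^ (γ * (u + 2)) := by
        congr 1
        · rw [Real.rpow_neg (by norm_num)]
          norm_num
        · rw [← pow_mul, ← Real.rpow_natCast, ← Real.rpow_mul (by norm_num)]
          congr 1
          push_cast
          field_simp
    _ = 2 ^ (-3 + γ * (u + 2)) := (Real.rpow_add (by norm_num) _ _).symm
    _ ≤ _ := by
        refine Real.rpow_le_rpow_of_exponent_le (by norm_num) ?_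
        linarith

theorem stmt14 :
    ∃ D : ℝ, 0 < D ∧ ∀ k : ℕ, 2 ≤ k →
      ∃ h0 : ℕ, 1 ≤ h0 ∧ (h0 : ℝ) ≤ D * 8 ^ k * k ^ 2 ∧
        ∀ h : ℕ, h0 ≤ h → ∀ ε : ℝ, 0 < ε →
          ∃ A : Set ℕ, A ⊆ kPow k ∧ ∃ C : ℝ, 0 < C ∧ ∃ c : ℝ, 0 < c ∧
            (∀ n : ℕ, 1 ≤ n → (Rcnt A h n : ℝ) ≤ C) ∧
            ∃ x0 : ℝ, ∀ x : ℝ, x0 ≤ x →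
              c * x ^ (1 / (h : ℝ) - ε) ≤ (countBelow A x : ℝ) := by
  classical
  refine ⟨1, one_pos, fun k hk => ⟨2 ^ k, Nat.one_le_two_pow, ?_, fun h hh ε hε => ?_⟩⟩
  · have h1 : (1 : ℝ) ≤ (k : ℝ) ^ 2 := one_le_pow₀ (by exact_mod_cast (by omega : 1 ≤ k))
    have h2 : (2 : ℝ) ^ k ≤ 8 ^ k := by gcongr; norm_num
    push_cast
    nlinarith [pow_pos (show (0 : ℝ) < 8 by norm_num) k]
  have hk0 : (0 : ℝ) < k := by exact_mod_cast (by omega : 0 < k)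
  have hh0 : (0 : ℝ) < h := by exact_mod_cast lt_of_lt_of_le (by positivity) hh
  have hkh : (k : ℝ) ≤ h := by exact_mod_cast Nat.lt_two_pow_self.le.trans hh
  set ε' := min ε (1 / (2 * h)) with hε'
  have hε'0 : 0 < ε' := lt_min hε (by positivity)
  have hε'1 : ε' ≤ ε := min_le_left _ _
  have hε'2 : ε' < 1 / h := (min_le_right _ _).trans_lt (by gcongr; linarith)
  set γ := k * (1 / h - ε') with hγ
  have hγ0 : 0 < γ := mul_pos hk0 (sub_pos.2 hε'2)
  have hγ1 : γ ≤ 1 := by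
    calc γ ≤ k * (1 / h) := by
          rw [hγ]
          gcongr
          linarith
      _ ≤ 1 := by rwa [mul_one_div, div_le_one hh0]
  have hγη : (k : ℝ) / h - 3 * (k * ε' / 3) = γ := by
    rw [hγ]
    ring
  obtain ⟨B, hB, T, hT⟩ := exists_sparse_set k hk h hh (k * ε' / 3) (by positivity)
    (fun u => ⌊γ * (u : ℝ)⌋₊)
    (fun u => Nat.floor_le_of_le (mul_le_of_le_one_left (Nat.cast_nonneg u) hγ1))
    (fun u => by
      rw [hγη]
      exact Nat.floor_le (by positivity))
  refine ⟨{a | ∃ m ∈ B, 1 ≤ m ∧ a = m ^ k}, ?_, ((T * h) ^ h : ℕ) + 1, by positivity, 1 / 8,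
    by norm_num, fun n _ => ?_, 2 ^ k, fun x hx => ?_⟩
  · rintro a ⟨m, -, hm, rfl⟩
    exact ⟨m, hm, rfl⟩
  · have h1 := (Rcnt_le_card_filter_powSets k (by omega) B h n).trans
      (card_filter_powSets_le k h T (by omega) B hT h le_rfl n)
    have h2 : (Rcnt {a | ∃ m ∈ B, 1 ≤ m ∧ a = m ^ k} h n : ℝ) ≤ ((T * h) ^ h : ℕ) := by
      exact_mod_cast h1
    linarith
  · refine le_trans ?_ (le_countBelow_powers k (by omega) γ hγ0 hγ1 B hB x hx)
    have hx1 : 1 ≤ x := le_trans (one_le_pow₀ (by norm_num)) hx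
    have h1 : γ / k = 1 / h - ε' := by
      rw [hγ]
      field_simp
    rw [h1]
    gcongr
end
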